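/- arXiv:2409.15522 — 4 statements merged into one kernel-verified Lean document; each statement's English description precedes it below -/
import Mathlib

section
/- Every connected finite graph (multiple edges allowed, no loops) that is not a regular bipartite graph has a spanning weakly even tree, i.e., a spanning tree T such that all leaves of T that have maximum degree in G belong to the same part of the bipartition of T. -/
/-- A multigraph on vertex type `V` with edge type `E`: each edge is assigned an
unordered pair of distinct endpoints (multiple edges allowed, no loops). -/
structure Multigraph (V : Type) (E : Type) where
  inc : E → Sym2 V
  loopless : ∀ e : E, ¬ (inc e).IsDiag

namespace Multigraph

variable {V E : Type}

/-- `u` and `v` are joined by an edge belonging to the edge set `S`. -/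
def AdjOn (G : Multigraph V E) (S : Set E) (u v : V) : Prop :=
  ∃ e ∈ S, G.inc e = s(u, v)

/-- `v` is reachable from `u` using edges in `S`. -/
def ReachOn (G : Multigraph V E) (S : Set E) (u v : V) : Prop :=
  Relation.ReflTransGen (G.AdjOn S) u v

/-- `G` is connected. -/
def Connected (G : Multigraph V E) : Prop :=
  Nonempty V ∧ ∀ u v : V, G.ReachOn Set.univ u v

/-- The degree of `v` in the spanning subgraph with edge set `S`. -/
noncomputable def degOn (G : Multigraph V E) (S : Set E) (v : V) : ℕ :=
  {e ∈ S | v ∈ G.inc e}.ncard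

/-- The degree of `v` in `G`. -/
noncomputable def degree (G : Multigraph V E) (v : V) : ℕ :=
  G.degOn Set.univ v

/-- The maximum degree `Δ(G)`. -/
noncomputable def maxDegree (G : Multigraph V E) [Fintype V] : ℕ :=
  Finset.univ.sup G.degree

/-- `G` is regular. -/
def IsRegular (G : Multigraph V E) : Prop :=
  ∃ r : ℕ, ∀ v : V, G.degree v = r

/-- The 2-colouring `c` is proper on the edge set `S`: the two endpoints of any
edge of `S` receive different colours. -/
def ProperOn (G : Multigraph V E) (S : Set E) (c : V → Bool) : Prop :=
  ∀ e ∈ S, ∀ u v : V, G.inc e = s(u, v) → c u ≠ c v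

/-- `G` is bipartite. -/
def IsBipartite (G : Multigraph V E) : Prop :=
  ∃ c : V → Bool, G.ProperOn Set.univ c

/-- The sub-multigraph of `G` with vertex set `U` and edge set `S` is a tree:
`U` is nonempty, every edge of `S` joins vertices of `U`, any two vertices of `U`
are joined by a walk using edges of `S`, and there are exactly `|U| - 1` edges
(which forces acyclicity, and in particular forbids parallel edges in `S`). -/
structure IsTree (G : Multigraph V E) (U : Set V) (S : Set E) : Prop where
  nonempty : U.Nonempty
  edges_in : ∀ e ∈ S, ∀ v : V, v ∈ G.inc e → v ∈ U
  conn : ∀ u ∈ U, ∀ v ∈ U, G.ReachOn S u v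
  card_eq : S.ncard + 1 = U.ncard

/-- `v` is a leaf of the subgraph with edge set `S`. -/
def IsLeaf (G : Multigraph V E) (S : Set E) (v : V) : Prop :=
  G.degOn S v = 1

/-- `e` is a cutedge: after removing `e`, some pair of vertices is separated. -/
def IsCutedge (G : Multigraph V E) (e : E) : Prop :=
  ∃ u v : V, ¬ G.ReachOn {e}ᶜ u v

/-- `G` is 2-edge-connected: connected and without cutedges. -/
def TwoEdgeConnected (G : Multigraph V E) : Prop :=
  G.Connected ∧ ∀ e : E, ¬ G.IsCutedge e

/-- The edge set `S` is a weak 2-factor of `G`: every vertex has degree at most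
2 in `S` (equivalently, every component of the spanning subgraph is a path —
possibly a single vertex — or a cycle), and every vertex of degree less than 2
in `S` (i.e. every endvertex of a path component) has degree less than `Δ(G)`
in `G`. -/
def IsWeakTwoFactor (G : Multigraph V E) [Fintype V] (S : Set E) : Prop :=
  ∀ v : V, G.degOn S v ≤ 2 ∧ (G.degOn S v < 2 → G.degree v < G.maxDegree)

end Multigraph

open SimpleGraph

def crossG {V : Type} (G : SimpleGraph V) (A : Finset V) : SimpleGraph V where
  Adj u v := G.Adj u v ∧ (u ∈ A ↔ v ∉ A)
  symm := ⟨fun u v h => ⟨h.1.symm, by have := h.2; tauto⟩⟩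
  loopless := ⟨fun u h => G.loopless.irrefl u h.1⟩

theorem exists_dom {V : Type} [Fintype V] (G : SimpleGraph V) (hc : G.Connected) :
    ∃ A : Finset V, (∀ u ∈ A, ∀ v ∈ A, ¬ G.Adj u v) ∧ (crossG G A).Connected := by
  classical
  obtain ⟨r⟩ := hc.nonempty
  let P : Finset V → Prop := fun A => r ∈ A ∧ (∀ u ∈ A, ∀ v ∈ A, ¬ G.Adj u v) ∧
    ∀ u, (u ∈ A ∨ ∃ a ∈ A, G.Adj a u) → (crossG G A).Reachable r u
  have hP0 : P {r} := by
    refine ⟨by simp, by simp, ?_⟩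
    intro u hu
    rcases hu with hu | ⟨a, ha, hau⟩
    · simp at hu; subst hu; exact Reachable.refl _
    · simp at ha; subst ha
      refine Adj.reachable ⟨hau, ?_⟩
      simp [hau.ne']
  obtain ⟨A, hA, hmax⟩ := (Finset.univ.filter P).exists_max_image Finset.card ⟨{r}, by simp [hP0]⟩
  simp only [Finset.mem_filter, Finset.mem_univ, true_and] at hA hmax
  obtain ⟨hr, hind, hre⟩ := hA
  have hall : ∀ u, (u ∈ A ∨ ∃ a ∈ A, G.Adj a u) := by
    by_contra! hcon
    obtain ⟨x, hx⟩ := hcon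
    obtain ⟨p⟩ := hc.preconnected r x
    obtain ⟨d, -, hd1, hd2⟩ := p.exists_boundary_dart {u | (u ∈ A ∨ ∃ a ∈ A, G.Adj a u)} (Or.inl hr)
      (by simpa using hx)
    obtain ⟨⟨b, v⟩, hbv⟩ := d
    simp only [Set.mem_setOf_eq, not_or, not_exists, not_and] at hd1 hd2 hbv
    have hbA : b ∉ A := fun h => hd2.2 b h hbv
    have hmono : crossG G A ≤ crossG G (insert v A) := by
      intro u w h
      obtain ⟨h1, h2⟩ := h
      refine ⟨h1, ?_⟩
      by_cases hu : u ∈ A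
      · have hw := h2.1 hu
        have : w ≠ v := fun e => hd2.2 u hu (e ▸ h1)
        simp [hu, hw, this]
      · have hw : w ∈ A := by tauto
        have : u ≠ v := fun e => hd2.2 w hw (e ▸ h1.symm)
        simp [hu, hw, this]
    have hvr : (crossG G (insert v A)).Reachable r v := by
      refine ((hre b hd1).mono hmono).trans (Adj.reachable ⟨hbv, ?_⟩)
      simp [hbA, hbv.ne]
    have := hmax (insert v A) ⟨by simp [hr], ?_, ?_⟩
    · rw [Finset.card_insert_of_notMem hd2.1] at this; omega
    · intro u hu w hw h
      rw [Finset.mem_insert] at hu hw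
      rcases hu with rfl | hu <;> rcases hw with rfl | hw
      · exact h.ne rfl
      · exact hd2.2 w hw h.symm
      · exact hd2.2 u hu h
      · exact hind u hu w hw h
    · intro u hu
      by_cases huv : u = v
      · rw [huv]; exact hvr
      by_cases hu' : (u ∈ A ∨ ∃ a ∈ A, G.Adj a u)
      · exact (hre u hu').mono hmono
      · have hvu : G.Adj v u := by
          simp only [Finset.mem_insert] at hu
          grind
        refine hvr.trans (Adj.reachable ⟨hvu, ?_⟩)
        simp only [Finset.mem_insert, true_or, true_iff]; tauto
  refine ⟨A, hind, ?_⟩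
  haveI : Nonempty V := ⟨r⟩
  exact ⟨fun u v => (hre u (hall u)).symm.trans (hre v (hall v))⟩

theorem lovasz {V : Type} [DecidableEq V] (A : Finset V) : ∀ (n : ℕ) (N : V → Finset V), ∑ a ∈ A, (N a).card = n →
    (∀ X ⊆ A, X.Nonempty → X.card + 1 ≤ (X.biUnion N).card) →
    ∃ N' : V → Finset V, (∀ a ∈ A, N' a ⊆ N a) ∧ (∀ a ∈ A, (N' a).card = 2) ∧
     (∀ X ⊆ A, X.Nonempty → X.card + 1 ≤ (X.biUnion N').card) := by
  intro n
  induction n using Nat.strong_induction_on with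
  | _ n ih =>
  intro N hn hN
  by_cases h2 : ∀ a ∈ A, (N a).card = 2
  · exact ⟨N, fun _ _ => Finset.Subset.refl _, h2, hN⟩
  push Not at h2
  obtain ⟨a, ha, hane⟩ := h2
  have hage : 2 ≤ (N a).card := by
    simpa using hN {a} (by simpa using ha) (by simp)
  -- either removable or tight
  have key : ∀ b ∈ N a, (∃ N' : V → Finset V, (∀ a ∈ A, N' a ⊆ N a) ∧ (∀ a ∈ A, (N' a).card = 2) ∧
     (∀ X ⊆ A, X.Nonempty → X.card + 1 ≤ (X.biUnion N').card)) ∨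
     ∃ X ⊆ A, a ∈ X ∧ (X.biUnion N).card = X.card + 1 ∧ ∀ x ∈ X, x ≠ a → b ∉ N x := by
    intro b hb
    let M := Function.update N a ((N a).erase b)
    have hMN : ∀ x, M x ⊆ N x := by
      intro x
      by_cases hx : x = a
      · subst hx; simp [M, Finset.erase_subset]
      · simp [M, hx]
    by_cases hM : ∀ X ⊆ A, X.Nonempty → X.card + 1 ≤ (X.biUnion M).card
    · left
      have hlt : ∑ x ∈ A, (M x).card < n := by
        rw [← hn]
        refine Finset.sum_lt_sum (fun x _ => Finset.card_le_card (hMN x)) ⟨a, ha, ?_⟩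
        simp only [M, Function.update_self]
        exact Finset.card_erase_lt_of_mem hb
      obtain ⟨N', h1, h2, h3⟩ := ih _ hlt M rfl hM
      exact ⟨N', fun x hx => (h1 x hx).trans (hMN x), h2, h3⟩
    · right
      push Not at hM
      obtain ⟨X, hXA, hXne, hX⟩ := hM
      have hge := hN X hXA hXne
      have hsub : (X.biUnion N) ⊆ insert b (X.biUnion M) := by
        intro y hy
        simp only [Finset.mem_biUnion, Finset.mem_insert] at hy ⊢
        obtain ⟨x, hx, hy⟩ := hy
        by_cases hyb : y = b
        · exact Or.inl hyb
        · right
          refine ⟨x, hx, ?_⟩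
          by_cases hxa : x = a
          · subst hxa; simp [M, hyb, hy]
          · simp [M, hxa, hy]
      have hc1 := (Finset.card_le_card hsub).trans (Finset.card_insert_le _ _)
      have hbM : b ∉ X.biUnion M := by
        intro hb
        rw [Finset.insert_eq_of_mem hb] at hsub
        have := Finset.card_le_card hsub
        omega
      refine ⟨X, hXA, ?_, by omega, ?_⟩
      · by_contra haX
        have : X.biUnion M = X.biUnion N := by
          refine Finset.biUnion_congr rfl fun x hx => ?_
          have : x ≠ a := fun e => haX (e ▸ hx)
          simp [M, this]
        rw [this] at hX; omega
      · intro x hx hxa hbx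
        apply hbM
        rw [Finset.mem_biUnion]
        exact ⟨x, hx, by simpa [M, hxa] using hbx⟩
  obtain ⟨b1, hb1, b2, hb2, hne⟩ := Finset.one_lt_card.1 (by omega : 1 < (N a).card)
  rcases key b1 hb1 with h | ⟨X1, hX1, ha1, ht1, hp1⟩
  · exact h
  rcases key b2 hb2 with h | ⟨X2, hX2, ha2, ht2, hp2⟩
  · exact h
  exfalso
  have hU := hN (X1 ∪ X2) (Finset.union_subset hX1 hX2) ⟨a, by simp [ha1]⟩
  have hcU := Finset.card_union_add_card_inter X1 X2
  have hcN := Finset.card_union_add_card_inter (X1.biUnion N) (X2.biUnion N)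
  rw [← Finset.union_biUnion] at hcN
  have hI : ((X1 ∩ X2).biUnion N) ⊆ X1.biUnion N ∩ X2.biUnion N := by
    intro y hy; simp only [Finset.mem_biUnion, Finset.mem_inter] at *; grind
  have hIc := Finset.card_le_card hI
  have haY : a ∈ X1 ∩ X2 := by simp [ha1, ha2]
  by_cases hY : ((X1 ∩ X2).erase a).Nonempty
  · have h3 := hN _ ((Finset.erase_subset _ _).trans (Finset.inter_subset_left.trans hX1)) hY
    rw [Finset.card_erase_of_mem haY] at h3
    have hsub : insert b1 (insert b2 (((X1 ∩ X2).erase a).biUnion N)) ⊆ (X1 ∩ X2).biUnion N := by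
      intro y hy; simp only [Finset.mem_biUnion, Finset.mem_insert, Finset.mem_erase] at *; grind
    have hc := Finset.card_le_card hsub
    rw [Finset.card_insert_of_notMem, Finset.card_insert_of_notMem] at hc
    · have := Finset.card_pos.2 ⟨a, haY⟩
      omega
    · simp only [Finset.mem_biUnion, Finset.mem_erase, Finset.mem_inter]; grind
    · simp only [Finset.mem_biUnion, Finset.mem_erase, Finset.mem_inter, Finset.mem_insert]; grind
  · have : X1 ∩ X2 = {a} := by
      rw [Finset.not_nonempty_iff_eq_empty, Finset.erase_eq_empty_iff] at hY
      rcases hY with h | h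
      · rw [h] at haY; simp at haY
      · exact h
    rw [this] at hIc hcU
    simp at hIc hcU
    omega

def starG {V : Type} (A : Finset V) (N : V → Finset V) (hN : ∀ a ∈ A, ∀ b ∈ N a, b ∉ A) :
    SimpleGraph V where
  Adj u v := (u ∈ A ∧ v ∈ N u) ∨ (v ∈ A ∧ u ∈ N v)
  symm := ⟨fun u v h => Or.symm h⟩
  loopless := ⟨fun u h => by
    rcases h with h | h <;> exact hN u h.1 u h.2 h.1⟩

theorem starG_acyclic {V : Type} [DecidableEq V] (A : Finset V) (N : V → Finset V)
    (hN : ∀ a ∈ A, ∀ b ∈ N a, b ∉ A) (h2 : ∀ a ∈ A, (N a).card = 2)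
    (hH : ∀ X ⊆ A, X.Nonempty → X.card + 1 ≤ (X.biUnion N).card) :
    (starG A N hN).IsAcyclic := by
  intro u p hp
  have hnb : ∀ v ∈ p.support, ∃ x y, x ≠ y ∧ x ∈ p.support ∧ y ∈ p.support ∧
      (starG A N hN).Adj v x ∧ (starG A N hN).Adj v y := by
    intro v hv
    have := hp.ncard_neighborSet_toSubgraph_eq_two hv
    rw [Set.ncard_eq_two] at this
    obtain ⟨x, y, hxy, he⟩ := this
    have hx : x ∈ p.toSubgraph.neighborSet v := by rw [he]; simp
    have hy : y ∈ p.toSubgraph.neighborSet v := by rw [he]; simp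
    rw [SimpleGraph.Subgraph.mem_neighborSet] at hx hy
    exact ⟨x, y, hxy, p.mem_verts_toSubgraph.1 (p.toSubgraph.edge_vert hx.symm),
      p.mem_verts_toSubgraph.1 (p.toSubgraph.edge_vert hy.symm), hx.adj_sub, hy.adj_sub⟩
  let X := p.support.toFinset.filter (· ∈ A)
  let Y := p.support.toFinset.filter (· ∉ A)
  have hXA : X ⊆ A := fun x hx => (Finset.mem_filter.1 hx).2
  have hsub : X.biUnion N ⊆ Y := by
    intro b hb
    obtain ⟨a, ha, hb⟩ := Finset.mem_biUnion.1 hb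
    obtain ⟨ha1, ha2⟩ := Finset.mem_filter.1 ha
    rw [List.mem_toFinset] at ha1
    obtain ⟨x, y, hxy, hx, hy, hax, hay⟩ := hnb a ha1
    have hx' : x ∈ N a := by
      rcases hax with h | h
      · exact h.2
      · exact absurd ha2 (hN _ h.1 _ h.2)
    have hy' : y ∈ N a := by
      rcases hay with h | h
      · exact h.2
      · exact absurd ha2 (hN _ h.1 _ h.2)
    have : ({x, y} : Finset V) = N a := by
      apply Finset.eq_of_subset_of_card_le
      · intro z hz; simp at hz; rcases hz with rfl | rfl <;> assumption
      · rw [h2 a ha2, Finset.card_pair hxy]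
    rw [← this] at hb
    simp only [Finset.mem_insert, Finset.mem_singleton] at hb
    simp only [Y, Finset.mem_filter, List.mem_toFinset]
    rcases hb with rfl | rfl
    · exact ⟨hx, hN a ha2 _ hx'⟩
    · exact ⟨hy, hN a ha2 _ hy'⟩
  have hXne : X.Nonempty := by
    by_cases hu : u ∈ A
    · exact ⟨u, by simp [X, hu]⟩
    · obtain ⟨x, y, hxy, hx, hy, hax, hay⟩ := hnb u (by simp)
      rcases hax with h | h
      · exact absurd h.1 hu
      · exact ⟨x, by simp [X, hx, h.1]⟩
  have h1 := hH X hXA hXne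
  have h3 := Finset.card_le_card hsub
  have hdc := Finset.sum_card_bipartiteAbove_eq_sum_card_bipartiteBelow (s := X) (t := Y)
    (fun a b => b ∈ N a)
  have hle : ∑ a ∈ X, (Finset.bipartiteAbove (fun a b => b ∈ N a) Y a).card ≤ ∑ a ∈ X, 2 := by
    refine Finset.sum_le_sum fun a ha => ?_
    rw [← h2 a (hXA ha)]
    exact Finset.card_le_card fun z hz => (Finset.mem_filter.1 hz).2
  have hge : ∑ b ∈ Y, 2 ≤ ∑ b ∈ Y, (Finset.bipartiteBelow (fun a b => b ∈ N a) X b).card := by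
    refine Finset.sum_le_sum fun b hb => ?_
    obtain ⟨hb1, hb2⟩ := Finset.mem_filter.1 hb
    rw [List.mem_toFinset] at hb1
    obtain ⟨x, y, hxy, hx, hy, hax, hay⟩ := hnb b hb1
    rw [← Finset.card_pair hxy]
    refine Finset.card_le_card ?_
    intro z hz
    simp only [Finset.mem_insert, Finset.mem_singleton] at hz
    rw [Finset.mem_bipartiteBelow]
    rcases hz with rfl | rfl
    · rcases hax with h | h
      · exact absurd h.1 hb2
      · exact ⟨by simp [X, hx, h.1], h.2⟩
    · rcases hay with h | h
      · exact absurd h.1 hb2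
      · exact ⟨by simp [X, hy, h.1], h.2⟩
  simp at hle hge
  omega

namespace Multigraph
variable {V E : Type}

def toSG (G : Multigraph V E) : SimpleGraph V where
  Adj u v := ∃ e, G.inc e = s(u, v)
  symm := ⟨fun u v h => by obtain ⟨e, he⟩ := h; exact ⟨e, by rw [he, Sym2.eq_swap]⟩⟩
  loopless := ⟨fun u h => by obtain ⟨e, he⟩ := h; exact G.loopless e (by rw [he]; simp)⟩

theorem toSG_reach (G : Multigraph V E) (u v : V) (h : G.ReachOn Set.univ u v) :
    G.toSG.Reachable u v := by
  induction h with
  | refl => exact Reachable.refl _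
  | tail _ h ih =>
    obtain ⟨e, -, he⟩ := h
    exact ih.trans (Adj.reachable ⟨e, he⟩)

theorem expand [Fintype V] [Fintype E] [DecidableEq V] (G : Multigraph V E) (hconn : G.Connected)
    (hG : ¬ (G.IsRegular ∧ G.IsBipartite)) (A X Y : Finset V)
    (hA : ∀ u ∈ A, ∀ v ∈ A, ¬ G.toSG.Adj u v) (hXA : X ⊆ A) (hX : X.Nonempty)
    (hd : ∀ x ∈ X, G.degree x = G.maxDegree)
    (hY : ∀ y, y ∈ Y ↔ ∃ x ∈ X, G.toSG.Adj x y) : X.card + 1 ≤ Y.card := by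
  classical
  by_contra hlt
  have hdeg : ∀ v, G.degree v = (Finset.univ.filter (fun e => v ∈ G.inc e)).card := by
    intro v
    rw [degree, degOn, ← Set.ncard_coe_finset]
    congr 1
    ext e; simp
  have hmax : ∀ v, G.degree v ≤ G.maxDegree := fun v => Finset.le_sup (Finset.mem_univ v)
  let I : V → Finset E := fun v => Finset.univ.filter (fun e => v ∈ G.inc e)
  let EX := X.biUnion I
  have hother : ∀ e v, v ∈ G.inc e → ∃ w, G.inc e = s(v, w) := fun e v h =>
    ⟨_, (Sym2.other_spec h).symm⟩
  have hEX : EX.card = X.card * G.maxDegree := by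
    rw [Finset.card_biUnion, ← smul_eq_mul, ← Finset.sum_const]
    · exact Finset.sum_congr rfl fun x hx => by rw [← hd x hx, hdeg]
    · intro x hx y hy hxy
      rw [Function.onFun, Finset.disjoint_left]
      intro e he he'
      simp only [I, Finset.mem_filter, Finset.mem_univ, true_and] at he he'
      refine hA x (hXA hx) y (hXA hy) ⟨e, ?_⟩
      exact (Sym2.mem_and_mem_iff hxy).1 ⟨he, he'⟩
  have hYA : ∀ y ∈ Y, y ∉ A := by
    intro y hy hyA
    obtain ⟨x, hx, h⟩ := (hY y).1 hy
    exact hA x (hXA hx) y hyA h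
  have hEXsub : EX ⊆ Y.biUnion (fun y => EX ∩ I y) := by
    intro e he
    obtain ⟨x, hx, hxe⟩ := Finset.mem_biUnion.1 he
    simp only [I, Finset.mem_filter, Finset.mem_univ, true_and] at hxe
    obtain ⟨w, hw⟩ := hother e x hxe
    refine Finset.mem_biUnion.2 ⟨w, (hY w).2 ⟨x, hx, e, hw⟩, ?_⟩
    simp [he, I, hw]
  have hc1 : EX.card ≤ ∑ y ∈ Y, (EX ∩ I y).card :=
    (Finset.card_le_card hEXsub).trans Finset.card_biUnion_le
  have hle : ∀ y ∈ Y, (EX ∩ I y).card ≤ G.maxDegree := fun y _ =>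
    (Finset.card_le_card Finset.inter_subset_right).trans ((hdeg y).symm.le.trans (hmax y))
  have hc2 := Finset.sum_le_sum hle
  have hc3 : ∑ y ∈ Y, G.maxDegree ≤ X.card * G.maxDegree := by
    rw [Finset.sum_const, smul_eq_mul]
    exact Nat.mul_le_mul_right _ (by omega)
  have heq := (Finset.sum_eq_sum_iff_of_le hle).1 (by omega)
  have hYd : ∀ y ∈ Y, G.degree y = G.maxDegree := by
    intro y hy
    refine le_antisymm (hmax y) ?_
    rw [← heq y hy, hdeg]
    exact Finset.card_le_card Finset.inter_subset_right
  have hYn : ∀ y ∈ Y, ∀ v, G.toSG.Adj y v → v ∈ X := by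
    intro y hy v ⟨e, he⟩
    have h1 : EX ∩ I y = I y := by
      apply Finset.eq_of_subset_of_card_le Finset.inter_subset_right
      rw [heq y hy]
      exact (hdeg y).symm.le.trans (hmax y)
    have h2 : e ∈ EX ∩ I y := by rw [h1]; simp [I, he]
    obtain ⟨x, hx, hxe⟩ := Finset.mem_biUnion.1 (Finset.mem_inter.1 h2).1
    simp only [I, Finset.mem_filter, Finset.mem_univ, true_and, he, Sym2.mem_iff] at hxe
    rcases hxe with rfl | rfl
    · exact absurd (hXA hx) (hYA _ hy)
    · exact hx
  have hall : ∀ v, v ∈ X ∨ v ∈ Y := by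
    obtain ⟨x, hx⟩ := hX
    intro v
    obtain ⟨p⟩ := G.toSG_reach x v (hconn.2 x v)
    by_contra hv
    obtain ⟨d, -, hd1, hd2⟩ := p.exists_boundary_dart {u | u ∈ X ∨ u ∈ Y} (Or.inl hx) hv
    obtain ⟨⟨a, b⟩, hab⟩ := d
    apply hd2
    rcases hd1 with h | h
    · exact Or.inr ((hY b).2 ⟨a, h, hab⟩)
    · exact Or.inl (hYn a h b hab)
  refine hG ⟨⟨G.maxDegree, fun v => (hall v).elim (hd v) (hYd v)⟩, fun v => decide (v ∈ A), ?_⟩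
  intro e _ u v he
  have hadj : G.toSG.Adj u v := ⟨e, he⟩
  rcases hall u with hu | hu
  · have hv : v ∉ A := hYA v ((hY v).2 ⟨u, hu, hadj⟩)
    simp [hXA hu, hv]
  · have hv := hXA (hYn u hu v hadj)
    simp [hYA u hu, hv]

end Multigraph

theorem spanning_weakly_even_tree_exists {V E : Type} [Fintype V] [Fintype E]
    (G : Multigraph V E) (hconn : G.Connected)
    (hG : ¬ (G.IsRegular ∧ G.IsBipartite)) :
    ∃ (S : Set E) (c : V → Bool),
      G.IsTree Set.univ S ∧
      G.ProperOn S c ∧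
      ∀ u v : V, G.IsLeaf S u → G.degree u = G.maxDegree →
        G.IsLeaf S v → G.degree v = G.maxDegree → c u = c v := by
  classical
  have hne := hconn.1
  obtain ⟨A, hind, hH⟩ := exists_dom G.toSG ⟨fun u v => G.toSG_reach u v (hconn.2 u v)⟩
  let A0 := A.filter (fun v => G.degree v = G.maxDegree)
  have hA0 : A0 ⊆ A := Finset.filter_subset _ _
  obtain ⟨N, hN1, hN2, hN3⟩ := lovasz A0 _ (fun v => Finset.univ.filter (fun w => G.toSG.Adj v w))
    rfl (fun X hX hXne => G.expand hconn hG A X _ hind (hX.trans hA0) hXne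
      (fun x hx => (Finset.mem_filter.1 (hX hx)).2) (by simp))
  have hNadj : ∀ a ∈ A0, ∀ b ∈ N a, G.toSG.Adj a b := fun a ha b hb => by
    simpa using hN1 a ha hb
  have hNA : ∀ a ∈ A0, ∀ b ∈ N a, b ∉ A := fun a ha b hb hbA =>
    hind a (hA0 ha) b hbA (hNadj a ha b hb)
  have hNA0 : ∀ a ∈ A0, ∀ b ∈ N a, b ∉ A0 := fun a ha b hb h => hNA a ha b hb (hA0 h)
  have hac := starG_acyclic A0 N hNA0 hN2 hN3
  have hle : starG A0 N hNA0 ≤ crossG G.toSG A := by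
    intro u v h
    rcases h with h | h
    · have := hNA u h.1 v h.2
      exact ⟨hNadj u h.1 v h.2, by simp [hA0 h.1, this]⟩
    · have := hNA v h.1 u h.2
      exact ⟨(hNadj v h.1 u h.2).symm, by simp [hA0 h.1, this]⟩
  obtain ⟨T, hT1, hT2, hT⟩ := hH.exists_isTree_le_of_le_of_isAcyclic hle hac
  have hch : ∀ e : T.edgeSet, ∃ e' : E, G.inc e' = e := by
    rintro ⟨e, he⟩
    induction e using Sym2.ind with
    | _ u v => exact (hT2 he).1
  choose g hg using hch
  have hginj : Function.Injective g := fun a b h => by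
    apply Subtype.ext; rw [← hg a, ← hg b, h]
  have hTS : ∀ u v, T.Adj u v → ∃ e ∈ Set.range g, G.inc e = s(u, v) := fun u v h =>
    ⟨_, ⟨⟨s(u, v), h⟩, rfl⟩, hg _⟩
  have hST : ∀ e ∈ Set.range g, ∀ u v, G.inc e = s(u, v) → T.Adj u v := by
    rintro _ ⟨e, rfl⟩ u v h
    rw [hg] at h
    have := e.2
    rwa [h] at this
  refine ⟨Set.range g, fun v => decide (v ∈ A), ⟨?_, ?_, ?_, ?_⟩, ?_, ?_⟩
  · exact Set.univ_nonempty
  · intros; trivial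
  · intro u _ v _
    obtain ⟨p⟩ := hT.connected.preconnected u v
    induction p with
    | nil => exact Relation.ReflTransGen.refl
    | cons h _ ih => exact Relation.ReflTransGen.head (hTS _ _ h) (ih trivial trivial)
  · have h1 := hT.card_edgeFinset
    rw [Set.ncard_univ, Nat.card_eq_fintype_card, ← h1, ← Set.image_univ,
      Set.ncard_image_of_injective _ hginj, Set.ncard_univ, Nat.card_eq_fintype_card,
      SimpleGraph.edgeFinset_card]
  · intro e he u v h
    have := (hT2 (hST e he u v h)).2
    by_cases hu : u ∈ A
    · simp [hu, this.1 hu]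
    · have : v ∈ A := by tauto
      simp [hu, this]
  · have key : ∀ u, G.IsLeaf (Set.range g) u → G.degree u = G.maxDegree → u ∉ A := by
      intro u hu hd huA
      have hu0 : u ∈ A0 := Finset.mem_filter.2 ⟨huA, hd⟩
      obtain ⟨x, y, hxy, hxyN⟩ := Finset.card_eq_two.1 (hN2 u hu0)
      obtain ⟨e, he, hex⟩ := hTS u x (hT1 (Or.inl ⟨hu0, by simp [hxyN]⟩))
      obtain ⟨f, hf, hfy⟩ := hTS u y (hT1 (Or.inl ⟨hu0, by simp [hxyN]⟩))
      obtain ⟨k, hk⟩ := Set.ncard_eq_one.1 hu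
      have h1 : e ∈ ({k} : Set E) := by rw [← hk]; exact ⟨he, by simp [hex]⟩
      have h2 : f ∈ ({k} : Set E) := by rw [← hk]; exact ⟨hf, by simp [hfy]⟩
      have h3 : e = f := h1.trans h2.symm
      rw [h3, hfy] at hex
      exact hxy (Sym2.congr_right.1 hex).symm
    intro u v hu hdu hv hdv
    simp [key u hu hdu, key v hv hdv]
end

section
/- Every regular nonbipartite connected finite graph (multiple edges allowed, no loops) has a spanning even tree, i.e., a spanning tree T such that all leaves of T belong to the same part of the bipartition of T. -/
namespace Multigraph

variable {V E : Type}

theorem AdjOn.symm' {G : Multigraph V E} {S : Set E} {u v : V} (h : G.AdjOn S u v) :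
    G.AdjOn S v u := by
  obtain ⟨e, he, h⟩ := h
  exact ⟨e, he, by rw [h, Sym2.eq_swap]⟩

theorem ReachOn.symm' {G : Multigraph V E} {S : Set E} {u v : V} (h : G.ReachOn S u v) :
    G.ReachOn S v u := by
  unfold ReachOn at *
  induction h with
  | refl => exact Relation.ReflTransGen.refl
  | tail _ h2 ih => exact Relation.ReflTransGen.head h2.symm' ih

theorem ReachOn.mono' {G : Multigraph V E} {S T : Set E} (hST : S ⊆ T) {u v : V}
    (h : G.ReachOn S u v) : G.ReachOn T u v := by
  unfold ReachOn at *
  induction h with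
  | refl => exact Relation.ReflTransGen.refl
  | tail _ h2 ih =>
    obtain ⟨e, he, h⟩ := h2
    exact Relation.ReflTransGen.tail ih ⟨e, hST he, h⟩

theorem reach_cross {G : Multigraph V E} {S : Set E} {x y : V} (h : G.ReachOn S x y)
    (U : Set V) (hx : x ∈ U) (hy : y ∉ U) : ∃ u ∈ U, ∃ w, w ∉ U ∧ G.AdjOn S u w := by
  unfold ReachOn at h
  induction h with
  | refl => exact absurd hx hy
  | @tail b c h1 h2 ih =>
    by_cases hb : b ∈ U
    · exact ⟨b, hb, c, hy, h2⟩
    · exact ih hb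

theorem adj_ne {G : Multigraph V E} {S : Set E} {u v : V} (h : G.AdjOn S u v) : u ≠ v := by
  obtain ⟨e, he, h⟩ := h
  rintro rfl
  apply G.loopless e
  rw [h]; simp

/-- `B` is independent. -/
def Indep (G : Multigraph V E) (B : Set V) : Prop :=
  ∀ u ∈ B, ∀ v ∈ B, ¬ G.AdjOn Set.univ u v

/-- edges touching `B`. -/
def touch (G : Multigraph V E) (B : Set V) : Set E := {e | ∃ b ∈ B, b ∈ G.inc e}

theorem exists_indep [Fintype V] (G : Multigraph V E) (hconn : G.Connected) :
    ∃ (B : Set V) (v0 : V), G.Indep B ∧ ∀ u, G.ReachOn (G.touch B) v0 u := by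
  obtain ⟨⟨v0⟩, hc⟩ := hconn
  let P : Set (Set V) := {B | G.Indep B ∧ v0 ∈ B ∧ ∀ b ∈ B, G.ReachOn (G.touch B) v0 b}
  have hP : ({v0} : Set V) ∈ P := by
    refine ⟨?_, rfl, ?_⟩
    · rintro u rfl v rfl h
      exact adj_ne h rfl
    · rintro b rfl
      exact Relation.ReflTransGen.refl
  obtain ⟨B, hB⟩ := (Set.toFinite P).exists_maximal ⟨_, hP⟩
  obtain ⟨hBP, hmax⟩ := hB
  obtain ⟨hi, hv, hr⟩ := hBP
  refine ⟨B, v0, hi, ?_⟩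
  have hN : ∀ b ∈ B, ∀ u, G.AdjOn Set.univ b u → G.ReachOn (G.touch B) v0 u := by
    rintro b hb u ⟨e, -, he⟩
    exact Relation.ReflTransGen.tail (hr b hb) ⟨e, ⟨b, hb, by rw [he]; simp⟩, he⟩
  by_contra hcon
  push Not at hcon
  obtain ⟨y, hy⟩ := hcon
  let W : Set V := {u | u ∈ B ∨ ∃ b ∈ B, G.AdjOn Set.univ b u}
  have hyW : y ∉ W := by
    rintro (h | ⟨b, hb, h⟩)
    · exact hy (hr y h)
    · exact hy (hN b hb y h)
  obtain ⟨u, hu, w, hw, huw⟩ := reach_cross (hc v0 y) W (Or.inl hv) hyW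
  have hwB : w ∉ B := fun h => hw (Or.inl h)
  have hwN : ∀ b ∈ B, ¬ G.AdjOn Set.univ b w := fun b hb h => hw (Or.inr ⟨b, hb, h⟩)
  have hsub : G.touch B ⊆ G.touch (insert w B) := by
    rintro e ⟨b, hb, h⟩
    exact ⟨b, Or.inr hb, h⟩
  have hru : G.ReachOn (G.touch B) v0 u := by
    rcases hu with h | ⟨b, hb, h⟩
    · exact hr u h
    · exact hN b hb u h
  have : insert w B ∈ P := by
    refine ⟨?_, Or.inr hv, ?_⟩
    · rintro a (rfl | ha) b (rfl | hb) h
      · exact adj_ne h rfl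
      · exact hwN b hb h.symm'
      · exact hwN a ha h
      · exact hi a ha b hb h
    · rintro b (rfl | hb)
      · obtain ⟨e, -, he⟩ := huw
        exact Relation.ReflTransGen.tail (hru.mono' hsub) ⟨e, ⟨b, Or.inl rfl, by rw [he]; simp⟩, he⟩
      · exact (hr b hb).mono' hsub
  exact hwB (hmax this (Set.subset_insert _ _) (Or.inl rfl))

theorem strict_hall [Fintype V] [Fintype E] (G : Multigraph V E) (hreg : G.IsRegular)
    (hnb : ¬ G.IsBipartite) (hconn : G.Connected) (B : Set V) (hB : G.Indep B)
    (X N : Finset V) (hX : X.Nonempty) (hXB : ∀ x ∈ X, x ∈ B)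
    (hN : ∀ v, v ∈ N ↔ ∃ x ∈ X, G.AdjOn Set.univ x v) : X.card + 1 ≤ N.card := by
  classical
  by_contra hlt
  have hle : N.card ≤ X.card := by omega
  obtain ⟨r, hr⟩ := hreg
  let F : V → Finset E := fun v => Finset.univ.filter (fun e => v ∈ G.inc e)
  have hF : ∀ v, (F v).card = r := by
    intro v
    rw [← hr v, degree, degOn, ← Set.ncard_coe_finset]
    congr 1
    ext e; simp [F]
  have h1 : (X.biUnion F).card = X.card * r := by
    rw [Finset.card_biUnion]
    · simp [hF]
    · intro x hx y hy hxy
      refine Finset.disjoint_left.2 ?_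
      intro e he he'
      simp only [F, Finset.mem_filter, Finset.mem_univ, true_and] at he he'
      exact hB x (hXB x hx) y (hXB y hy) ⟨e, trivial, (Sym2.mem_and_mem_iff hxy).1 ⟨he, he'⟩⟩
  have h2 : (N.biUnion F).card ≤ N.card * r :=
    Finset.card_biUnion_le_card_mul _ _ _ (fun v _ => (hF v).le)
  have hsub : X.biUnion F ⊆ N.biUnion F := by
    intro e he
    simp only [F, Finset.mem_biUnion, Finset.mem_filter, Finset.mem_univ, true_and] at he ⊢
    obtain ⟨x, hx, hxe⟩ := he
    obtain ⟨y, hy⟩ := Sym2.mem_iff_exists.1 hxe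
    exact ⟨y, (hN y).2 ⟨x, hx, e, trivial, hy⟩, by rw [hy]; simp⟩
  have heq : X.biUnion F = N.biUnion F := by
    apply Finset.eq_of_subset_of_card_le hsub
    rw [h1]
    exact h2.trans (Nat.mul_le_mul_right _ hle)
  have hback : ∀ u ∈ N, ∀ v, G.AdjOn Set.univ u v → v ∈ X := by
    rintro u hu v ⟨e, -, he⟩
    have : e ∈ N.biUnion F := by
      simp only [F, Finset.mem_biUnion, Finset.mem_filter, Finset.mem_univ, true_and]
      exact ⟨u, hu, by rw [he]; simp⟩
    rw [← heq] at this
    simp only [F, Finset.mem_biUnion, Finset.mem_filter, Finset.mem_univ, true_and] at this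
    obtain ⟨x, hx, hxe⟩ := this
    rw [he, Sym2.mem_iff] at hxe
    rcases hxe with rfl | rfl
    · exfalso
      obtain ⟨x', hx', h⟩ := (hN x).1 hu
      exact hB _ (hXB _ hx') _ (hXB _ hx) h
    · exact hx
  have hall : ∀ v, v ∈ X ∨ v ∈ N := by
    obtain ⟨x, hx⟩ := hX
    intro v
    by_contra hv
    obtain ⟨u, hu, w, hw, huw⟩ := reach_cross (hconn.2 x v) {v | v ∈ X ∨ v ∈ N} (Or.inl hx) hv
    apply hw
    rcases hu with hu | hu
    · exact Or.inr ((hN w).2 ⟨u, hu, huw⟩)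
    · exact Or.inl (hback u hu w huw)
  apply hnb
  refine ⟨fun v => decide (v ∈ X), ?_⟩
  intro e _ u v he
  have hadj : G.AdjOn Set.univ u v := ⟨e, trivial, he⟩
  by_cases hu : u ∈ X
  · have hv : v ∉ X := fun hv => hB _ (hXB _ hu) _ (hXB _ hv) hadj
    simp [hu, hv]
  · have hv : v ∈ X := hback u ((hall u).resolve_left hu) v hadj
    simp [hu, hv]

theorem exists_matching [Fintype V] [Fintype E] (G : Multigraph V E) (hreg : G.IsRegular)
    (hnb : ¬ G.IsBipartite) (hconn : G.Connected) (B : Set V) (hB : G.Indep B) (a : V) :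
    ∃ m : V → V, Set.InjOn m B ∧ ∀ b ∈ B, G.AdjOn Set.univ b (m b) ∧ m b ≠ a := by
  classical
  let t : B → Finset V := fun b =>
    (Finset.univ.filter (fun v => G.AdjOn Set.univ b.1 v)).erase a
  have key : ∃ f : B → V, Function.Injective f ∧ ∀ x, f x ∈ t x := by
    rw [← Finset.all_card_le_biUnion_card_iff_exists_injective]
    intro s
    rcases s.eq_empty_or_nonempty with rfl | hs
    · simp
    let X : Finset V := s.image Subtype.val
    let N : Finset V := Finset.univ.filter (fun v => ∃ x ∈ X, G.AdjOn Set.univ x v)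
    have h := G.strict_hall hreg hnb hconn B hB X N (hs.image _)
      (by intro x hx; simp only [X, Finset.mem_image] at hx; obtain ⟨y, _, rfl⟩ := hx; exact y.2)
      (by simp [N])
    have hX : X.card = s.card := Finset.card_image_of_injective _ Subtype.val_injective
    have hsub : N.erase a ⊆ s.biUnion t := by
      intro v hv
      simp only [N, X, t, Finset.mem_erase, Finset.mem_filter, Finset.mem_univ, true_and,
        Finset.mem_image, Finset.mem_biUnion] at hv ⊢
      obtain ⟨hva, x, ⟨y, hy, rfl⟩, hadj⟩ := hv
      exact ⟨y, hy, hva, hadj⟩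
    have := Finset.card_le_card hsub
    have h3 := Finset.pred_card_le_card_erase (s := N) (a := a)
    omega
  obtain ⟨f, hf, hft⟩ := key
  refine ⟨fun v => if h : v ∈ B then f ⟨v, h⟩ else a, ?_, ?_⟩
  · intro x hx y hy hxy
    simp only [hx, hy, dif_pos] at hxy
    exact congrArg Subtype.val (hf hxy)
  · intro b hb
    have := hft ⟨b, hb⟩
    simp only [t, Finset.mem_erase, Finset.mem_filter, Finset.mem_univ, true_and] at this
    simp only [hb, dif_pos]
    exact ⟨this.2, this.1⟩

theorem IsTree.pendant [Finite V] [Finite E] {G : Multigraph V E} {U : Set V} {S : Set E}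
    (h : G.IsTree U S) {u w : V} (hu : u ∈ U) (hw : w ∉ U) {e : E} (he : G.inc e = s(u, w)) :
    G.IsTree (insert w U) (insert e S) := by
  have heS : e ∉ S := fun h' => hw (h.edges_in e h' w (by rw [he]; simp))
  have hadj : G.AdjOn (insert e S) u w := ⟨e, Or.inl rfl, he⟩
  have hall : ∀ x ∈ insert w U, G.ReachOn (insert e S) u x := by
    rintro x (rfl | hx)
    · exact Relation.ReflTransGen.single hadj
    · exact (h.conn u hu x hx).mono' (Set.subset_insert _ _)
  refine ⟨⟨w, Or.inl rfl⟩, ?_, ?_, ?_⟩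
  · rintro f (rfl | hf) v hv
    · rw [he, Sym2.mem_iff] at hv
      rcases hv with rfl | rfl
      · exact Or.inr hu
      · exact Or.inl rfl
    · exact Or.inr (h.edges_in f hf v hv)
  · intro x hx y hy
    exact Relation.ReflTransGen.trans (hall x hx).symm' (hall y hy)
  · rw [Set.ncard_insert_of_notMem heS, Set.ncard_insert_of_notMem hw, h.card_eq]

theorem degOn_mono [Finite E] (G : Multigraph V E) {S T : Set E} (h : S ⊆ T) (v : V) :
    G.degOn S v ≤ G.degOn T v :=
  Set.ncard_le_ncard (fun _ he => ⟨h he.1, he.2⟩) (Set.toFinite _)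

/-- Invariant of the growing process. -/
structure Inv (G : Multigraph V E) (B : Set V) (U : Set V) (S : Set E) : Prop where
  tree : G.IsTree U S
  tch : S ⊆ G.touch B
  deg : ∀ b ∈ B, b ∈ U → 2 ≤ G.degOn S b
  mat : ∃ m : V → V, Set.InjOn m (B \ U) ∧ ∀ b ∈ B \ U, G.AdjOn Set.univ b (m b) ∧ m b ∉ U

theorem Inv.step [Fintype V] [Fintype E] {G : Multigraph V E} {B U : Set V} {S : Set E}
    (hB : G.Indep B) {v0 : V} (hr : ∀ u, G.ReachOn (G.touch B) v0 u)
    (hm : ∀ a, ∃ m : V → V, Set.InjOn m B ∧ ∀ b ∈ B, G.AdjOn Set.univ b (m b) ∧ m b ≠ a)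
    (h : G.Inv B U S) (hU : U ≠ Set.univ) :
    ∃ U' S', G.Inv B U' S' ∧ U.ncard < U'.ncard := by
  by_cases hcase : ∃ a ∈ U, ∃ b ∈ B, b ∉ U ∧ G.AdjOn Set.univ a b
  · obtain ⟨a, ha, b, hb, hbU, e1, -, he1⟩ := hcase
    obtain ⟨m, hinj, hmm⟩ := h.mat
    obtain ⟨hadj, hmU⟩ := hmm b ⟨hb, hbU⟩
    have hne := adj_ne hadj
    obtain ⟨e2, -, he2⟩ := hadj
    have hmB : m b ∉ B := fun h' => hB b hb _ h' ⟨e2, trivial, he2⟩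
    have hmU' : m b ∉ insert b U := by
      rintro (h' | h')
      · exact hne h'.symm
      · exact hmU h'
    refine ⟨insert (m b) (insert b U), insert e2 (insert e1 S), ⟨?_, ?_, ?_, ?_⟩, ?_⟩
    · exact (h.tree.pendant ha hbU he1).pendant (Or.inl rfl) hmU' he2
    · rintro e (rfl | rfl | he)
      · exact ⟨b, hb, by rw [he2]; simp⟩
      · exact ⟨b, hb, by rw [he1]; simp⟩
      · exact h.tch he
    · rintro x hx (rfl | rfl | hxU)
      · exact absurd hx hmB
      · have hee : e2 ≠ e1 := by
          rintro rfl
          rw [he1, Sym2.eq_swap, Sym2.congr_right] at he2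
          exact hmU (he2 ▸ ha)
        rw [← Set.ncard_pair hee]
        apply Set.ncard_le_ncard _ (Set.toFinite _)
        rintro e (rfl | rfl)
        · exact ⟨Or.inl rfl, by rw [he2]; simp⟩
        · exact ⟨Or.inr (Or.inl rfl), by rw [he1]; simp⟩
      · exact (h.deg x hx hxU).trans
          (G.degOn_mono ((Set.subset_insert _ _).trans (Set.subset_insert _ _)) x)
    · refine ⟨m, ?_, ?_⟩
      · refine hinj.mono ?_
        rintro x ⟨hx, hx'⟩
        exact ⟨hx, fun h' => hx' (Or.inr (Or.inr h'))⟩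
      · rintro x ⟨hx, hx'⟩
        have hxU : x ∉ U := fun h' => hx' (Or.inr (Or.inr h'))
        obtain ⟨h1, h2⟩ := hmm x ⟨hx, hxU⟩
        refine ⟨h1, ?_⟩
        rintro (h' | h' | h')
        · have := hinj ⟨hx, hxU⟩ ⟨hb, hbU⟩ h'
          exact hx' (Or.inr (Or.inl this))
        · rw [h'] at h1
          exact hB x hx b hb h1
        · exact h2 h'
    · rw [Set.ncard_insert_of_notMem hmU', Set.ncard_insert_of_notMem hbU]
      omega
  · push Not at hcase
    have hcr : ∃ u ∈ U, ∃ w, w ∉ U ∧ G.AdjOn (G.touch B) u w := by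
      by_cases hv : v0 ∈ U
      · obtain ⟨y, hy⟩ := (Set.ne_univ_iff_exists_notMem U).1 hU
        exact reach_cross (hr y) U hv hy
      · obtain ⟨y, hy⟩ := h.tree.nonempty
        exact reach_cross (hr y).symm' U hy hv
    obtain ⟨b, hbU, a, ha, e, he, hea⟩ := hcr
    have hadj : G.AdjOn Set.univ b a := ⟨e, trivial, hea⟩
    have haB : a ∉ B := fun h' => hcase b hbU a h' ha hadj
    obtain ⟨m, hinj, hmm⟩ := hm a
    refine ⟨insert a U, insert e S, ⟨h.tree.pendant hbU ha hea, ?_, ?_, ?_⟩, ?_⟩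
    · rintro f (rfl | hf)
      · exact he
      · exact h.tch hf
    · rintro x hx (rfl | hxU)
      · exact absurd hx haB
      · exact (h.deg x hx hxU).trans (G.degOn_mono (Set.subset_insert _ _) x)
    · refine ⟨m, hinj.mono Set.sdiff_subset, ?_⟩
      rintro x ⟨hx, hx'⟩
      obtain ⟨h1, h2⟩ := hmm x hx
      refine ⟨h1, ?_⟩
      rintro (h' | h')
      · exact h2 h'
      · exact hcase _ h' x hx (fun h'' => hx' (Or.inr h'')) h1.symm'
    · rw [Set.ncard_insert_of_notMem ha]
      omega

end Multigraph

/-- Every regular nonbipartite connected multigraph has a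
spanning even tree: a spanning tree `T` (with edge set `S`, whose
unique-up-to-swap bipartition is given by a proper 2-colouring `c`) such that
all leaves of `T` belong to the same part of the bipartition of `T`. -/
theorem spanning_even_tree_of_regular_nonbipartite {V E : Type} [Fintype V] [Fintype E]
    (G : Multigraph V E) (hreg : G.IsRegular) (hnb : ¬ G.IsBipartite)
    (hconn : G.Connected) :
    ∃ (S : Set E) (c : V → Bool),
      G.IsTree Set.univ S ∧
      G.ProperOn S c ∧
      ∀ u v : V, G.IsLeaf S u → G.IsLeaf S v → c u = c v := by
  classical
  obtain ⟨B, v0, hB, hr⟩ := G.exists_indep hconn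
  have hm := G.exists_matching hreg hnb hconn B hB
  have hA : ∃ a0, a0 ∉ B := by
    by_contra hcon
    push Not at hcon
    apply hnb
    refine ⟨fun _ => true, ?_⟩
    intro e _ u v he
    exact absurd ⟨e, trivial, he⟩ (hB u (hcon u) v (hcon v))
  obtain ⟨a0, ha0⟩ := hA
  have key : ∀ n : ℕ, ∀ U S, G.Inv B U S → Fintype.card V - U.ncard ≤ n →
      ∃ S, G.Inv B Set.univ S := by
    intro n
    induction n with
    | zero =>
      intro U S h hn
      by_cases hU : U = Set.univ
      · exact ⟨S, hU ▸ h⟩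
      · have := Set.ncard_lt_card hU
        rw [Nat.card_eq_fintype_card] at this
        omega
    | succ n ih =>
      intro U S h hn
      by_cases hU : U = Set.univ
      · exact ⟨S, hU ▸ h⟩
      · obtain ⟨U', S', h', hlt⟩ := h.step hB hr hm hU
        exact ih U' S' h' (by omega)
  have hinit : G.Inv B {a0} ∅ := by
    refine ⟨⟨⟨a0, rfl⟩, ?_, ?_, by simp⟩, Set.empty_subset _, ?_, ?_⟩
    · intro e he
      exact absurd he (Set.notMem_empty e)
    · rintro u rfl v rfl
      exact Relation.ReflTransGen.refl
    · rintro b hb rfl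
      exact absurd hb ha0
    · obtain ⟨m, hinj, hmm⟩ := hm a0
      exact ⟨m, hinj.mono Set.sdiff_subset, fun b hb => hmm b hb.1⟩
  obtain ⟨S, hS⟩ := key _ _ _ hinit le_rfl
  have hleaf : ∀ u, G.IsLeaf S u → u ∉ B := by
    intro u hu hb
    have := hS.deg u hb trivial
    rw [Multigraph.IsLeaf] at hu
    omega
  refine ⟨S, fun v => decide (v ∈ B), hS.tree, ?_, ?_⟩
  · intro e he u v huv
    have hadj : G.AdjOn Set.univ u v := ⟨e, trivial, huv⟩
    obtain ⟨b, hb, hbe⟩ := hS.tch he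
    rw [huv, Sym2.mem_iff] at hbe
    rcases hbe with rfl | rfl
    · have hv : v ∉ B := fun hv => hB _ hb _ hv hadj
      simp [hb, hv]
    · have hu : u ∉ B := fun hu => hB _ hu _ hb hadj
      simp [hb, hu]
  · intro u v hu hv
    simp [hleaf u hu, hleaf v hv]
end

section
/- Every 2-edge-connected finite graph G (multiple edges allowed, no loops) that is not regular has a weak 2-factor, i.e., a spanning subgraph F each of whose components is either a cycle or a path (possibly a single vertex) such that every endvertex of a path component of F has degree strictly less than Δ(G) in G. -/
theorem gad_odd {k a a' b b' : ℕ} (hk : 1 ≤ k) (ha : a + a' = k + 2) (hb : b + b' = k)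
    (h : Odd (a + b)) : k ≤ a * b' + a' * b ∧
      (k + 2 ≤ a * b' + a' * b ∨ (a = 1 ∧ b = 0) ∨ (a' = 1 ∧ b' = 0)) := by
  obtain ⟨m, hm⟩ := h
  rcases Nat.eq_zero_or_pos b with rfl | hb0
  · have : b' = k := by omega
    subst this
    have : a = 1 ∨ 3 ≤ a := by omega
    rcases this with rfl | h3
    · simp
    · refine ⟨by nlinarith, Or.inl (by nlinarith)⟩
  rcases Nat.eq_zero_or_pos b' with rfl | hb0'
  · have : b = k := by omega
    subst this
    have : a' = 1 ∨ 3 ≤ a' := by omega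
    rcases this with rfl | h3
    · simp
    · refine ⟨by nlinarith, Or.inl (by nlinarith)⟩
  rcases Nat.eq_zero_or_pos a with rfl | ha0
  · have : a' = k + 2 := by omega
    subst this
    refine ⟨by nlinarith, Or.inl (by nlinarith)⟩
  rcases Nat.eq_zero_or_pos a' with rfl | ha0'
  · have : a = k + 2 := by omega
    subst this
    refine ⟨by nlinarith, Or.inl (by nlinarith)⟩
  have : k + 2 ≤ a * b' + a' * b := by
    obtain ⟨a, rfl⟩ := Nat.exists_eq_add_of_le ha0
    obtain ⟨a', rfl⟩ := Nat.exists_eq_add_of_le ha0'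
    obtain ⟨b, rfl⟩ := Nat.exists_eq_add_of_le hb0
    obtain ⟨b', rfl⟩ := Nat.exists_eq_add_of_le hb0'
    nlinarith [Nat.zero_le (a * b'), Nat.zero_le (a' * b)]
  exact ⟨by omega, Or.inl this⟩

theorem gad_even {k a a' b b' : ℕ} (hk : 1 ≤ k) (ha : a + a' = k + 2) (hb : b + b' = k)
    (h : ¬ Odd (a + b)) : 2 ≤ a * b' + a' * b ∨ (a = 0 ∧ b = 0) ∨ (a' = 0 ∧ b' = 0) := by
  rw [Nat.not_odd_iff_even] at h
  obtain ⟨m, hm⟩ := h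
  rcases Nat.eq_zero_or_pos b with rfl | hb0
  · have : b' = k := by omega
    subst this
    have : a = 0 ∨ 2 ≤ a := by omega
    rcases this with rfl | h3
    · simp
    · exact Or.inl (by nlinarith)
  rcases Nat.eq_zero_or_pos b' with rfl | hb0'
  · have : b = k := by omega
    subst this
    have : a' = 0 ∨ 2 ≤ a' := by omega
    rcases this with rfl | h3
    · simp
    · exact Or.inl (by nlinarith)
  rcases Nat.eq_zero_or_pos a with rfl | ha0
  · have : a' = k + 2 := by omega
    subst this
    exact Or.inl (by nlinarith)
  rcases Nat.eq_zero_or_pos a' with rfl | ha0'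
  · have : a = k + 2 := by omega
    subst this
    exact Or.inl (by nlinarith)
  exact Or.inl (by nlinarith [Nat.mul_pos ha0 hb0', Nat.mul_pos ha0' hb0])

section abs
open Classical Finset

variable {V P : Type} [Fintype V] [Fintype P]

noncomputable def wt (k : ℕ) (π : P → V) (σ : P → P) : P ⊕ V × Fin k → P ⊕ V × Fin k → ℕ
  | .inl p, .inl q => if σ p = q then 2 else 0
  | .inl p, .inr c => if π p = c.1 then 1 else 0
  | .inr c, .inl p => if π p = c.1 then 1 else 0
  | .inr _, .inr _ => 0

theorem wt_sum (k : ℕ) (π : P → V) (σ : P → P) (hσ : ∀ p, σ (σ p) = p)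
    (hf : ∀ v, #{p | π p = v} = k + 2) (y) : ∑ x, wt k π σ x y = k + 2 := by
  rcases y with q | c
  · simp only [Fintype.sum_sum_type, wt, Fintype.sum_prod_type]
    have h1 : ∀ p, σ p = q ↔ p = σ q := fun p => ⟨fun h => by rw [← h, hσ], fun h => by rw [h, hσ]⟩
    have h2 : ∑ v : V, ∑ _i : Fin k, (if π q = v then 1 else 0) = k := by
      rw [sum_eq_single (π q)]
      · simp
      · intro v _ hv; simp [hv.symm]
      · simp
    rw [h2]
    simp [h1]
    omega
  · simp [Fintype.sum_sum_type, wt, hf]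

noncomputable def cut (k : ℕ) (π : P → V) (σ : P → P) (C : Finset (P ⊕ V × Fin k)) : ℕ :=
  ∑ x, ∑ y, if x ∈ C ∧ y ∉ C then wt k π σ x y else 0

theorem cut_eq (k : ℕ) (π : P → V) (σ : P → P) (C : Finset (P ⊕ V × Fin k)) :
    cut k π σ C = ∑ v, (#{p | π p = v ∧ Sum.inl p ∈ C} * #{i : Fin k | Sum.inr (v, i) ∉ C}
      + #{p | π p = v ∧ Sum.inl p ∉ C} * #{i : Fin k | Sum.inr (v, i) ∈ C})
      + 2 * #{p | Sum.inl p ∈ C ∧ Sum.inl (σ p) ∉ C} := by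
  simp only [cut, Fintype.sum_sum_type, wt, sum_add_distrib, Fintype.sum_prod_type, card_filter]
  have h1 : ∑ p : P, ∑ q : P, (if Sum.inl p ∈ C ∧ Sum.inl q ∉ C then
      (if σ p = q then 2 else 0) else 0) =
      ∑ p, 2 * (if Sum.inl p ∈ C ∧ Sum.inl (σ p) ∉ C then 1 else 0) := by
    refine sum_congr rfl fun p _ => ?_
    rw [sum_eq_single (σ p)]
    · simp
    · intro q _ hq; simp [hq.symm]
    · simp
  have h2 : ∑ p : P, ∑ v : V, ∑ i : Fin k, (if Sum.inl p ∈ C ∧ Sum.inr (v, i) ∉ C then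
      (if π p = v then 1 else 0) else 0) =
      ∑ v, ∑ p, ∑ i : Fin k, (if π p = v ∧ Sum.inl p ∈ C then 1 else 0) *
        (if Sum.inr (v, i) ∉ C then 1 else 0) := by
    rw [sum_comm]
    refine sum_congr rfl fun v _ => sum_congr rfl fun p _ => sum_congr rfl fun i _ => ?_
    split_ifs <;> simp_all
  have h3 : ∑ v : V, ∑ i : Fin k, ∑ p : P, (if Sum.inr (v, i) ∈ C ∧ Sum.inl p ∉ C then
      (if π p = v then 1 else 0) else 0) =
      ∑ v, ∑ p, ∑ i : Fin k, (if π p = v ∧ Sum.inl p ∉ C then 1 else 0) *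
        (if Sum.inr (v, i) ∈ C then 1 else 0) := by
    refine sum_congr rfl fun v _ => ?_
    rw [sum_comm]
    refine sum_congr rfl fun p _ => sum_congr rfl fun i _ => ?_
    split_ifs <;> simp_all
  simp only [h1, h2, h3, sum_mul_sum]
  rw [mul_sum]
  simp only [sum_const_zero, ite_self, add_zero]
  ring

theorem card_C (k : ℕ) (π : P → V) (C : Finset (P ⊕ V × Fin k)) :
    #C = ∑ v, (#{p | π p = v ∧ Sum.inl p ∈ C} + #{i : Fin k | Sum.inr (v, i) ∈ C}) := by
  have : #C = ∑ x, if x ∈ C then 1 else 0 := by simp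
  rw [this]
  simp only [Fintype.sum_sum_type, sum_add_distrib, Fintype.sum_prod_type, card_filter]
  congr 1
  rw [sum_comm]
  refine sum_congr rfl fun p _ => ?_
  rw [sum_eq_single (π p)]
  · simp
  · intro q _ hq; simp [hq.symm]
  · simp

theorem key (k : ℕ) (hk : 1 ≤ k) (π : P → V) (σ : P → P) (hσ : ∀ p, σ (σ p) = p)
    (hf : ∀ v, #{p | π p = v} = k + 2)
    (hbr : ∀ W : Set V, W.Nonempty → W ≠ Set.univ → ∃ p q, p ≠ q ∧ π p ∈ W ∧ π q ∈ W ∧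
      π (σ p) ∉ W ∧ π (σ q) ∉ W)
    (C : Finset (P ⊕ V × Fin k)) (hC : Odd #C) (hd : ∀ p, Sum.inl p ∈ C → σ p ≠ p) :
    k ≤ cut k π σ C ∧ (k + 2 ≤ cut k π σ C ∨ ∃ x, ∀ y, y ≠ x → y ∈ C) := by
  rw [cut_eq]
  rw [card_C k π] at hC
  set a : V → ℕ := fun v => #{p | π p = v ∧ Sum.inl p ∈ C} with ha_def
  set a' : V → ℕ := fun v => #{p | π p = v ∧ Sum.inl p ∉ C} with ha'_def
  set b : V → ℕ := fun v => #{i : Fin k | Sum.inr (v, i) ∈ C} with hb_def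
  set b' : V → ℕ := fun v => #{i : Fin k | Sum.inr (v, i) ∉ C} with hb'_def
  set X := #{p | Sum.inl p ∈ C ∧ Sum.inl (σ p) ∉ C} with hX
  change k ≤ ∑ v, (a v * b' v + a' v * b v) + 2 * X ∧
    (k + 2 ≤ ∑ v, (a v * b' v + a' v * b v) + 2 * X ∨ _)
  change Odd (∑ v, (a v + b v)) at hC
  have ha : ∀ v, a v + a' v = k + 2 := by
    intro v
    rw [← hf v, ha_def, ha'_def]
    simp only
    rw [← filter_filter, ← filter_filter]
    exact card_filter_add_card_filter_not _
  have hb : ∀ v, b v + b' v = k := by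
    intro v
    have := card_filter_add_card_filter_not (s := (univ : Finset (Fin k)))
      (fun i => Sum.inr (v, i) ∈ C)
    simpa using this
  rw [Finset.odd_sum_iff_odd_card_odd] at hC
  set O : Finset V := univ.filter fun v => Odd (a v + b v) with hO
  have hOk : ∀ v ∈ O, k ≤ a v * b' v + a' v * b v := fun v hv =>
    (gad_odd hk (ha v) (hb v) (by simpa [hO] using hv)).1
  have hsumO : #O * k ≤ ∑ v, (a v * b' v + a' v * b v) := by
    calc #O * k ≤ ∑ v ∈ O, (a v * b' v + a' v * b v) := by
          simpa using card_nsmul_le_sum O _ k hOk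
      _ ≤ _ := sum_le_sum_of_subset (subset_univ _)
  have hOpos : 1 ≤ #O := hC.pos
  refine ⟨by nlinarith, ?_⟩
  by_contra hcon
  push Not at hcon
  obtain ⟨hlt, hnx⟩ := hcon
  have hO1 : #O = 1 := by
    obtain ⟨m, hm⟩ := hC
    rcases Nat.eq_zero_or_pos m with h0 | h0
    · omega
    · nlinarith
  obtain ⟨v0, hv0⟩ := card_eq_one.1 hO1
  have hv0O : Odd (a v0 + b v0) := by
    have : v0 ∈ O := by simp [hv0]
    simpa [hO] using this
  have g0 := gad_odd hk (ha v0) (hb v0) hv0O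
  have hX0 : X = 0 := by
    by_contra h
    have := hsumO
    rw [hO1] at this
    omega
  have hle0 : a v0 * b' v0 + a' v0 * b v0 ≤ ∑ v, (a v * b' v + a' v * b v) :=
    single_le_sum (f := fun v => a v * b' v + a' v * b v) (fun _ _ => Nat.zero_le _) (mem_univ v0)
  have hother : ∀ v, v ≠ v0 → (a v = 0 ∧ b v = 0) ∨ (a' v = 0 ∧ b' v = 0) := by
    intro v hv
    have hvO : ¬ Odd (a v + b v) := by
      intro h
      have : v ∈ O := by simpa [hO] using h
      rw [hv0] at this
      exact hv (by simpa using this)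
    rcases gad_even hk (ha v) (hb v) hvO with h | h
    · exfalso
      have h2 : ∑ u ∈ ({v, v0} : Finset V), (a u * b' u + a' u * b u) ≤
          ∑ v, (a v * b' v + a' v * b v) := sum_le_sum_of_subset (subset_univ _)
      rw [sum_pair hv] at h2
      omega
    · exact h
  have hcl : ∀ p, Sum.inl p ∈ C → Sum.inl (σ p) ∈ C := by
    intro p hp
    by_contra h
    have : p ∈ ({p | Sum.inl p ∈ C ∧ Sum.inl (σ p) ∉ C} : Finset P) := by simp [hp, h]
    rw [hX, card_eq_zero] at hX0
    rw [hX0] at this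
    simp at this
  have a0 : ∀ v, a v = 0 → ∀ p, π p = v → Sum.inl p ∉ C := by
    intro v h p hp hpC
    rw [ha_def] at h
    simp only [card_eq_zero, filter_eq_empty_iff, mem_univ, forall_const] at h
    exact h ⟨hp, hpC⟩
  have a'0 : ∀ v, a' v = 0 → ∀ p, π p = v → Sum.inl p ∈ C := by
    intro v h p hp
    by_contra hpC
    rw [ha'_def] at h
    simp only [card_eq_zero, filter_eq_empty_iff, mem_univ, forall_const] at h
    exact h ⟨hp, hpC⟩
  have b'0 : ∀ v, b' v = 0 → ∀ i, Sum.inr (v, i) ∈ C := by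
    intro v h i
    by_contra hpC
    rw [hb'_def] at h
    simp only [card_eq_zero, filter_eq_empty_iff, mem_univ, forall_const] at h
    exact h hpC
  rcases g0.2 with h | ⟨h1, -⟩ | ⟨h1, h2⟩
  · omega
  · obtain ⟨p0, hp0⟩ := card_eq_one.1 h1
    have hm : ∀ p, (π p = v0 ∧ Sum.inl p ∈ C) ↔ p = p0 := by
      intro p
      have := Finset.ext_iff.1 hp0 p
      simpa using this
    obtain ⟨hπ0, hp0C⟩ := (hm p0).2 rfl
    let W : Set V := {v | v ≠ v0 ∧ a' v = 0 ∧ b' v = 0}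
    have hWC : ∀ p, Sum.inl p ∈ C → p = p0 ∨ π p ∈ W := by
      intro p hp
      by_cases hv : π p = v0
      · exact Or.inl ((hm p).1 ⟨hv, hp⟩)
      · right
        rcases hother _ hv with h | h
        · exact absurd hp (a0 _ h.1 p rfl)
        · exact ⟨hv, h⟩
    have hWC' : ∀ p, π p ∈ W → Sum.inl p ∈ C := fun p hp => a'0 _ hp.2.1 p rfl
    have hs0 : π (σ p0) ∈ W := by
      rcases hWC _ (hcl p0 hp0C) with h | h
      · exact absurd h (hd p0 hp0C)
      · exact h
    obtain ⟨p, q, hpq, hp, hq, hp', hq'⟩ := hbr W ⟨_, hs0⟩ (by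
      intro h
      have : v0 ∈ W := by rw [h]; trivial
      exact this.1 rfl)
    apply hpq
    have e1 : σ p = p0 := (hWC _ (hcl p (hWC' p hp))).resolve_right hp'
    have e2 : σ q = p0 := (hWC _ (hcl q (hWC' q hq))).resolve_right hq'
    rw [← hσ p, ← hσ q, e1, e2]
  · obtain ⟨p0, hp0⟩ := card_eq_one.1 h1
    have hm : ∀ p, (π p = v0 ∧ Sum.inl p ∉ C) ↔ p = p0 := by
      intro p
      have := Finset.ext_iff.1 hp0 p
      simpa using this
    let W : Set V := {v | v = v0 ∨ a' v = 0 ∧ b' v = 0}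
    have hWC' : ∀ p, π p ∈ W → p ≠ p0 → Sum.inl p ∈ C := by
      rintro p (hp | hp) hne
      · by_contra h
        exact hne ((hm p).1 ⟨hp, h⟩)
      · exact a'0 _ hp.1 p rfl
    have hWC : ∀ p, Sum.inl p ∈ C → π p ∈ W := by
      intro p hp
      by_cases hv : π p = v0
      · exact Or.inl hv
      · rcases hother _ hv with h | h
        · exact absurd hp (a0 _ h.1 p rfl)
        · exact Or.inr h
    have hWu : W = Set.univ := by
      by_contra hne
      obtain ⟨p, q, hpq, hp, hq, hp', hq'⟩ := hbr W ⟨v0, Or.inl rfl⟩ hne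
      apply hpq
      have e1 : p = p0 := by
        by_contra h
        exact hp' (hWC _ (hcl p (hWC' p hp h)))
      have e2 : q = p0 := by
        by_contra h
        exact hq' (hWC _ (hcl q (hWC' q hq h)))
      rw [e1, e2]
    obtain ⟨y, hy, hyC⟩ := hnx (Sum.inl p0)
    apply hyC
    have hall : ∀ v, v ∈ W := fun v => by rw [hWu]; trivial
    rcases y with p | ⟨v, i⟩
    · exact hWC' p (hall _) (fun h => hy (by rw [h]))
    · rcases hall v with h | h
      · rw [h]; exact b'0 _ h2 i
      · exact b'0 _ h.2 i

theorem count {K : Type} [Fintype K] (k : ℕ) (hk : 1 ≤ k) (π : P → V) (σ : P → P)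
    (hσ : ∀ p, σ (σ p) = p)
    (hf : ∀ v, #{p | π p = v} = k + 2)
    (hbr : ∀ W : Set V, W.Nonempty → W ≠ Set.univ → ∃ p q, p ≠ q ∧ π p ∈ W ∧ π q ∈ W ∧
      π (σ p) ∉ W ∧ π (σ q) ∉ W)
    (f : P ⊕ V × Fin k → Option K)
    (hw : ∀ x y c, wt k π σ x y ≠ 0 → f x = some c → f y = some c ∨ f y = none)
    (hdg : ∀ p q c d, σ p = p → σ q = q → f (.inl p) = some c → f (.inl q) = some d → c = d) :
    #{c : K | Odd #{x | f x = some c}} ≤ #{x | f x = none} := by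
  set O : Finset K := {c : K | Odd #{x | f x = some c}} with hO
  set U : Finset (P ⊕ V × Fin k) := {x | f x = none} with hU
  have hcutU : ∀ c, cut k π σ {x | f x = some c} = ∑ x, ∑ y ∈ U, if f x = some c then wt k π σ x y else 0 := by
    intro c
    unfold cut
    refine sum_congr rfl fun x _ => ?_
    rw [hU, sum_filter]
    refine sum_congr rfl fun y _ => ?_
    simp only [mem_filter, mem_univ, true_and]
    by_cases hx : f x = some c
    · by_cases h0 : wt k π σ x y = 0
      · simp [h0]
      · rcases hw x y c h0 hx with h | h <;> simp [hx, h]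
    · simp [hx]
  have htot : ∑ c, cut k π σ {x | f x = some c} ≤ (k + 2) * #U := by
    simp only [hcutU]
    rw [sum_comm]
    calc _ ≤ ∑ x, ∑ y ∈ U, wt k π σ x y := by
          refine sum_le_sum fun x _ => ?_
          rw [sum_comm]
          refine sum_le_sum fun y _ => ?_
          cases hx : f x with
          | none => simp
          | some d => simp
      _ = _ := by
          rw [sum_comm]
          simp [wt_sum k π σ hσ hf, mul_comm]
  have hpar : Even (#U + #O) := by
    have hX : Fintype.card (P ⊕ V × Fin k) = #U + ∑ c, #{x | f x = some c} := by
      rw [← card_univ, card_eq_sum_card_fiberwise (f := f) (t := univ) (by simp),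
        Fintype.sum_option]
    have hXe : Even (Fintype.card (P ⊕ V × Fin k)) := by
      have : Fintype.card P = Fintype.card V * (k + 2) := by
        rw [← card_univ, card_eq_sum_card_fiberwise (f := π) (t := univ) (by simp)]
        simp [hf]
      simp only [Fintype.card_sum, Fintype.card_prod, Fintype.card_fin, this]
      exact ⟨Fintype.card V * (k + 1), by ring⟩
    rw [hX, Nat.even_add] at hXe
    rw [Nat.even_add, hXe, ← Nat.not_odd_iff_even, ← Nat.not_odd_iff_even,
      odd_sum_iff_odd_card_odd]
  by_contra hlt
  push Not at hlt
  have h2 : #U + 2 ≤ #O := by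
    obtain ⟨m, hm⟩ := hpar
    omega
  have hgood : ∀ c ∈ O, (∀ p, f (.inl p) = some c → σ p ≠ p) →
      k + 2 ≤ cut k π σ {x | f x = some c} := by
    intro c hc hd
    have hk' := key k hk π σ hσ hf hbr {x | f x = some c} (by simpa [hO] using hc) (by simpa using hd)
    rcases hk'.2 with h | ⟨x, hx⟩
    · exact h
    · exfalso
      obtain ⟨c', hc', hne⟩ : ∃ c' ∈ O, c' ≠ c := exists_mem_ne (by omega) c
      have hne' : ({x | f x = some c'} : Finset (P ⊕ V × Fin k)).Nonempty := by
        rw [← card_pos]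
        have : Odd #{x | f x = some c'} := by simpa [hO] using hc'
        exact this.pos
      obtain ⟨y, hy⟩ := hne'
      simp only [mem_filter, mem_univ, true_and, ne_eq] at hy hx
      have hyx : y = x := by
        by_contra h
        have := hx y h
        rw [hy] at this
        exact hne (by simpa using this)
      have hUe : U = ∅ := by
        rw [hU, filter_eq_empty_iff]
        intro z _ hz
        by_cases h : z = x
        · rw [h, ← hyx, hy] at hz; simp at hz
        · have := hx z h
          rw [hz] at this; simp at this
      have := hcutU c
      rw [hUe] at this
      simp at this
      omega
  obtain ⟨c0, hc0⟩ : ∃ c0 : K, ∀ c ∈ O, c ≠ c0 → (∀ p, f (.inl p) = some c → σ p ≠ p) := by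
    by_cases h : ∃ p c, f (.inl p) = some c ∧ σ p = p
    · obtain ⟨p, c0, h1, h2⟩ := h
      refine ⟨c0, fun c _ hne q hq hqq => hne ?_⟩
      exact hdg q p c c0 hqq h2 hq h1
    · push Not at h
      have : O.Nonempty := card_pos.1 (by omega)
      obtain ⟨c0, -⟩ := this
      exact ⟨c0, fun c _ _ p hp => h p c hp⟩
  have h3 : (k + 2) * #(O.erase c0) ≤ ∑ c, cut k π σ {x | f x = some c} := by
    calc (k + 2) * #(O.erase c0) ≤ ∑ c ∈ O.erase c0, cut k π σ {x | f x = some c} := by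
          rw [mul_comm]
          have := card_nsmul_le_sum (O.erase c0) (fun c => cut k π σ {x | f x = some c}) (k + 2)
            (fun c hc => hgood c (mem_of_mem_erase hc) (hc0 c (mem_of_mem_erase hc) (ne_of_mem_erase hc)))
          simpa using this
      _ ≤ _ := sum_le_sum_of_subset (subset_univ _)
  have h4 := pred_card_le_card_erase (s := O) (a := c0)
  have h5 : (k + 2) * (#U + 1) ≤ (k + 2) * #(O.erase c0) := Nat.mul_le_mul_left _ (by omega)
  nlinarith

theorem factor (k : ℕ) (hk : 1 ≤ k) (π : P → V) (σ : P → P)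
    (hσ : ∀ p, σ (σ p) = p)
    (hf : ∀ v, #{p | π p = v} = k + 2)
    (hbr : ∀ W : Set V, W.Nonempty → W ≠ Set.univ → ∃ p q, p ≠ q ∧ π p ∈ W ∧ π q ∈ W ∧
      π (σ p) ∉ W ∧ π (σ q) ∉ W) :
    ∃ T : Set P, (∀ p ∈ T, σ p ∈ T) ∧ ∀ v, #{p | π p = v ∧ p ∈ T} = 2 := by
  let H : SimpleGraph (P ⊕ V × Fin k) := SimpleGraph.fromRel fun x y =>
    wt k π σ x y ≠ 0 ∨ ∃ p q, x = .inl p ∧ y = .inl q ∧ σ p = p ∧ σ q = q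
  have hM : ∃ M : H.Subgraph, M.IsPerfectMatching := by
    rw [SimpleGraph.tutte]
    intro U hU
    rw [SimpleGraph.IsTutteViolator, ← not_le] at hU
    apply hU
    set D := ((⊤ : H.Subgraph).deleteVerts U) with hD
    have hDv : ∀ x, x ∈ D.verts ↔ x ∉ U := by intro x; simp [hD]
    let f : P ⊕ V × Fin k → Option D.coe.ConnectedComponent := fun x =>
      if h : x ∈ D.verts then some (D.coe.connectedComponentMk ⟨x, h⟩) else none
    have hfn : ∀ x, f x = none ↔ x ∈ U := by
      intro x
      simp only [f]
      split_ifs with h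
      · simpa using (hDv x).1 h
      · simpa using not_not.1 (fun h' => h ((hDv x).2 h'))
    have hfs : ∀ x c, f x = some c ↔ ∃ h : x ∈ D.verts, D.coe.connectedComponentMk ⟨x, h⟩ = c := by
      intro x c
      simp only [f]
      split_ifs with h
      · simp [h]
      · simp [h]
    have hadj : ∀ x y c d, H.Adj x y → f x = some c → f y = some d → c = d := by
      intro x y c d hxy hx hy
      obtain ⟨h1, rfl⟩ := (hfs _ _).1 hx
      obtain ⟨h2, rfl⟩ := (hfs _ _).1 hy
      rw [SimpleGraph.ConnectedComponent.eq]
      apply SimpleGraph.Adj.reachable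
      rw [SimpleGraph.Subgraph.coe_adj]
      simp only [hD, SimpleGraph.Subgraph.deleteVerts_adj]
      simpa [hxy] using ⟨(hDv x).1 h1, (hDv y).1 h2⟩
    have : Fintype D.coe.ConnectedComponent := Fintype.ofFinite _
    have hc := count k hk π σ hσ hf hbr f (by
      intro x y c hw hx
      cases hy : f y with
      | none => simp
      | some d =>
        left
        by_cases hxy : x = y
        · rw [← hy, ← hxy, hx]
        · rw [hadj x y c d (by simp only [H, SimpleGraph.fromRel_adj]; exact ⟨hxy, .inl (.inl hw)⟩) hx hy]) (by
      intro p q c d hp hq hc hd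
      by_cases hpq : p = q
      · rw [hpq, hd] at hc; simpa using hc.symm
      · refine hadj _ _ c d ?_ hc hd
        simp only [H, SimpleGraph.fromRel_adj]
        exact ⟨by simpa using hpq, .inl (.inr ⟨p, q, rfl, rfl, hp, hq⟩)⟩)
    have e1 : D.coe.oddComponents.ncard = #{c | Odd #{x | f x = some c}} := by
      rw [← Set.ncard_coe_finset]
      congr 1
      ext c
      have : c.supp.ncard = #{x | f x = some c} := by
        rw [← Set.ncard_coe_finset, ← Set.ncard_image_of_injective _ Subtype.val_injective]
        congr 1
        ext x
        simp [hfs]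
      simp [this]
    have e2 : U.ncard = #{x | f x = none} := by
      rw [← Set.ncard_coe_finset]
      congr 1
      ext x
      simp [hfn]
    rw [e1, e2]
    exact hc
  obtain ⟨M, hM⟩ := hM
  rw [SimpleGraph.Subgraph.isPerfectMatching_iff] at hM
  choose m hm hmu using hM
  have hmm : ∀ x, m (m x) = x := fun x => (hmu _ _ (hm x).symm).symm
  have hH : ∀ x, H.Adj x (m x) := fun x => (hm x).adj_sub
  refine ⟨{p | ∃ q, m (.inl p) = .inl q}, ?_, ?_⟩
  · rintro p ⟨q, hq⟩
    by_cases hp : σ p = p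
    · rw [hp]; exact ⟨q, hq⟩
    · have h1 := hH (.inl p)
      rw [hq] at h1
      simp only [H, SimpleGraph.fromRel_adj, wt] at h1
      have : q = σ p := by
        rcases h1.2 with (h | ⟨p', q', h, h', h2, h3⟩) | (h | ⟨p', q', h, h', h2, h3⟩)
        · by_contra hne
          simp [Ne.symm hne] at h
        · simp at h; subst h; exact absurd h2 hp
        · by_contra hne
          have : σ q ≠ p := fun e => hne (by rw [← e, hσ])
          simp [this] at h
        · simp at h'; subst h'; exact absurd h3 hp
      rw [← this]
      exact ⟨p, by rw [← hq, hmm]⟩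
  · intro v
    have hcore : ∀ i : Fin k, ∃ p, m (.inr (v, i)) = .inl p ∧ π p = v := by
      intro i
      have h1 := hH (.inr (v, i))
      cases h : m (.inr (v, i)) with
      | inl p =>
        refine ⟨p, rfl, ?_⟩
        rw [h] at h1
        simpa [H, SimpleGraph.fromRel_adj, wt] using h1
      | inr c =>
        rw [h] at h1
        simp [H, SimpleGraph.fromRel_adj, wt] at h1
    choose g hg hgπ using hcore
    have hginj : Function.Injective g := by
      intro i j hij
      have : m (.inr (v, i)) = m (.inr (v, j)) := by rw [hg, hg, hij]
      have := congrArg m this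
      rw [hmm, hmm] at this
      simpa using this
    have himg : ({p | π p = v ∧ p ∉ {p | ∃ q, m (.inl p) = .inl q}} : Finset P) = univ.image g := by
      ext p
      simp only [Set.mem_ofPred_eq, mem_filter, mem_univ, true_and, mem_image]
      constructor
      · rintro ⟨hp, hn⟩
        cases h : m (.inl p) with
        | inl q => exact absurd ⟨q, h⟩ hn
        | inr c =>
          have h1 := hH (.inl p)
          rw [h] at h1
          have h2 : π p = c.1 := by simpa [H, SimpleGraph.fromRel_adj, wt] using h1
          refine ⟨c.2, ?_⟩
          have h3 : (v, c.2) = c := by rw [← hp, h2]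
          have h4 := hg c.2
          rw [h3, ← h, hmm] at h4
          simpa using h4.symm
      · rintro ⟨i, rfl⟩
        refine ⟨hgπ i, ?_⟩
        rintro ⟨q, hq⟩
        rw [← hg, hmm] at hq
        simp at hq
    have h1 : #({p | π p = v ∧ p ∉ {p | ∃ q, m (.inl p) = .inl q}} : Finset P) = k := by
      rw [himg, card_image_of_injective _ hginj]; simp
    have h2 : #({p | π p = v ∧ p ∈ {p | ∃ q, m (.inl p) = .inl q}} : Finset P) +
        #({p | π p = v ∧ p ∉ {p | ∃ q, m (.inl p) = .inl q}} : Finset P) = k + 2 := by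
      rw [← hf v, ← filter_filter, ← filter_filter]
      exact card_filter_add_card_filter_not _
    rw [h1] at h2
    rw [add_comm] at h2
    convert Nat.add_left_cancel h2

end abs

theorem Multigraph.exists_cross {V E : Type} (G : Multigraph V E) (S : Set E) (W : Set V) (u v : V)
    (h : G.ReachOn S u v) (hu : u ∈ W) (hv : v ∉ W) :
    ∃ e ∈ S, ∃ x ∈ W, ∃ y, y ∉ W ∧ G.inc e = s(x, y) := by
  induction h with
  | refl => exact absurd hu hv
  | @tail b c hb hc ih =>
    by_cases hbW : b ∈ W
    · obtain ⟨e, he, h⟩ := hc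
      exact ⟨e, he, b, hbW, c, hv, h⟩
    · exact ih hbW

theorem Multigraph.exists_two_cross {V E : Type} (G : Multigraph V E) (h : G.TwoEdgeConnected)
    (W : Set V) (h1 : W.Nonempty) (h2 : W ≠ Set.univ) :
    ∃ e e', e ≠ e' ∧ (∃ x ∈ W, ∃ y, y ∉ W ∧ G.inc e = s(x, y)) ∧
      (∃ x ∈ W, ∃ y, y ∉ W ∧ G.inc e' = s(x, y)) := by
  obtain ⟨u, hu⟩ := h1
  obtain ⟨v, hv⟩ := (Set.ne_univ_iff_exists_notMem W).1 h2
  obtain ⟨e, -, he⟩ := G.exists_cross _ W u v (h.1.2 u v) hu hv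
  have h3 : G.ReachOn {e}ᶜ u v := by
    by_contra hc
    exact h.2 e ⟨u, v, hc⟩
  obtain ⟨e', hne, he'⟩ := G.exists_cross _ W u v h3 hu hv
  exact ⟨e, e', fun hh => hne hh.symm, he, he'⟩

section mainproof
open Classical Finset

abbrev Multigraph.Port {V E : Type} [Fintype V] (G : Multigraph V E) : Type :=
  {q : V × E // q.1 ∈ G.inc q.2} ⊕ (Σ v : V, Fin (G.maxDegree - G.degree v))

def Multigraph.pr {V E : Type} [Fintype V] (G : Multigraph V E) : G.Port → V
  | .inl q => q.1.1
  | .inr d => d.1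

noncomputable def Multigraph.sw {V E : Type} [Fintype V] (G : Multigraph V E) : G.Port → G.Port
  | .inl q => .inl ⟨(Sym2.Mem.other q.2, q.1.2), Sym2.other_mem q.2⟩
  | .inr d => .inr d

theorem Multigraph.sw_sw {V E : Type} [Fintype V] (G : Multigraph V E) (p : G.Port) :
    G.sw (G.sw p) = p := by
  rcases p with ⟨⟨v, e⟩, h⟩ | d
  · simp only [Multigraph.sw]
    congr 3
    exact Sym2.other_invol _ _
  · rfl

theorem Multigraph.degOn_eq {V E : Type} [Fintype V] [Fintype E] (G : Multigraph V E) (S : Set E)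
    (v : V) : G.degOn S v =
      #{q : {q : V × E // q.1 ∈ G.inc q.2} | q.1.1 = v ∧ q.1.2 ∈ S} := by
  unfold Multigraph.degOn
  rw [← Set.ncard_coe_finset]
  symm
  apply Set.ncard_congr (fun q _ => q.1.2)
  · rintro ⟨⟨u, e⟩, h⟩ hq
    simp at hq
    obtain ⟨rfl, h2⟩ := hq
    exact ⟨h2, h⟩
  · rintro ⟨⟨u, e⟩, h⟩ ⟨⟨u', e'⟩, h'⟩ hq hq' hee
    simp at hq hq' hee
    simp [hq.1, hq'.1, hee]
  · rintro e ⟨he, hv⟩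
    exact ⟨⟨(v, e), hv⟩, by simpa using he, rfl⟩

theorem Multigraph.degree_le {V E : Type} [Fintype V] (G : Multigraph V E) (v : V) :
    G.degree v ≤ G.maxDegree := Finset.le_sup (f := G.degree) (mem_univ v)

theorem card_sum_filter {A B : Type} [Fintype A] [Fintype B] (p : A ⊕ B → Prop) :
    #{x | p x} = #{a | p (.inl a)} + #{b | p (.inr b)} := by
  simp only [card_filter, Fintype.sum_sum_type]

theorem Multigraph.fib {V E : Type} [Fintype V] [Fintype E] (G : Multigraph V E) (v : V) :
    #{p : G.Port | G.pr p = v} = G.maxDegree := by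
  rw [card_sum_filter]
  have h1 : #{a : {q : V × E // q.1 ∈ G.inc q.2} | G.pr (.inl a) = v} = G.degree v := by
    rw [Multigraph.degree, Multigraph.degOn_eq]
    simp only [Multigraph.pr, Set.mem_univ, and_true]
    congr
  have h2 : #{b : (Σ v : V, Fin (G.maxDegree - G.degree v)) | G.pr (.inr b) = v}
      = G.maxDegree - G.degree v := by
    rw [card_filter, Fintype.sum_sigma, sum_eq_single v]
    · simp [Multigraph.pr]
    · intro u _ hu; simp [Multigraph.pr, hu]
    · simp
  rw [h1, h2]
  have := G.degree_le v
  omega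

theorem Multigraph.bridge {V E : Type} [Fintype V] (G : Multigraph V E)
    (h : G.TwoEdgeConnected) (W : Set V) (h1 : W.Nonempty) (h2 : W ≠ Set.univ) :
    ∃ p q, p ≠ q ∧ G.pr p ∈ W ∧ G.pr q ∈ W ∧ G.pr (G.sw p) ∉ W ∧ G.pr (G.sw q) ∉ W := by
  obtain ⟨e, e', hne, ⟨x, hx, y, hy, he⟩, ⟨x', hx', y', hy', he'⟩⟩ := G.exists_two_cross h W h1 h2
  have m1 : x ∈ G.inc e := by rw [he]; simp
  have m2 : x' ∈ G.inc e' := by rw [he']; simp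
  have o1 : Sym2.Mem.other m1 = y := by
    have := (Sym2.other_spec m1).trans he
    exact Sym2.congr_right.1 this
  have o2 : Sym2.Mem.other m2 = y' := by
    have := (Sym2.other_spec m2).trans he'
    exact Sym2.congr_right.1 this
  refine ⟨.inl ⟨(x, e), m1⟩, .inl ⟨(x', e'), m2⟩, by simp [hne], hx, hx', ?_, ?_⟩
  · simpa only [Multigraph.pr, Multigraph.sw, o1] using hy
  · simpa only [Multigraph.pr, Multigraph.sw, o2] using hy'

theorem Multigraph.three_le {V E : Type} [Fintype V] [Fintype E] (G : Multigraph V E)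
    (h2ec : G.TwoEdgeConnected) (hnreg : ¬ G.IsRegular) : 3 ≤ G.maxDegree := by
  by_contra hlt
  apply hnreg
  by_cases hs : Subsingleton V
  · obtain ⟨v⟩ := h2ec.1.1
    exact ⟨G.degree v, fun u => by rw [Subsingleton.elim u v]⟩
  rw [not_subsingleton_iff_nontrivial] at hs
  refine ⟨2, fun v => ?_⟩
  have h1 := G.degree_le v
  have h2 : 2 ≤ G.degree v := by
    obtain ⟨e, e', hne, ⟨x, hx, y, hy, he⟩, ⟨x', hx', y', hy', he'⟩⟩ :=
      G.exists_two_cross h2ec {v} ⟨v, rfl⟩ (by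
        intro h
        obtain ⟨u, hu⟩ := exists_ne v
        have : u ∈ ({v} : Set V) := by rw [h]; trivial
        exact hu this)
    rw [Set.mem_singleton_iff] at hx hx'
    subst hx
    subst hx'
    unfold Multigraph.degree Multigraph.degOn
    rw [← Set.ncard_pair hne]
    apply Set.ncard_le_ncard _ (Set.toFinite _)
    rintro f (rfl | rfl)
    · exact ⟨trivial, by rw [he]; simp⟩
    · exact ⟨trivial, by rw [he']; simp⟩
  omega

theorem Multigraph.main {V E : Type} [Fintype V] [Fintype E]
    (G : Multigraph V E) (h2ec : G.TwoEdgeConnected) (hnreg : ¬ G.IsRegular) :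
    ∃ S : Set E, G.IsWeakTwoFactor S := by
  have h3 := G.three_le h2ec hnreg
  obtain ⟨T, hT, hT2⟩ := factor (G.maxDegree - 2) (by omega) G.pr G.sw G.sw_sw
    (fun v => by rw [G.fib]; omega) (G.bridge h2ec)
  let S : Set E := {e | ∃ v, ∃ h : v ∈ G.inc e, (Sum.inl ⟨(v, e), h⟩ : G.Port) ∈ T}
  have hS : ∀ q : {q : V × E // q.1 ∈ G.inc q.2}, q.1.2 ∈ S ↔ (Sum.inl q : G.Port) ∈ T := by
    rintro ⟨⟨u, e⟩, hu⟩
    constructor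
    · rintro ⟨v, hv, hvT⟩
      by_cases huv : u = v
      · subst huv; exact hvT
      · have := hT _ hvT
        have ho : Sym2.Mem.other hv = u := by
          have h1 := Sym2.other_spec hv
          have h2 : u ∈ G.inc e := hu
          change s(v, Sym2.Mem.other hv) = G.inc e at h1
          rw [← h1, Sym2.mem_iff] at h2
          exact (h2.resolve_left huv).symm
        simpa only [Multigraph.sw, ho] using this
    · intro h
      exact ⟨u, hu, h⟩
  refine ⟨S, fun v => ?_⟩
  have h2 : #{a : {q : V × E // q.1 ∈ G.inc q.2} |
      G.pr (.inl a) = v ∧ (Sum.inl a : G.Port) ∈ T} +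
      #{b : (Σ v : V, Fin (G.maxDegree - G.degree v)) |
      G.pr (.inr b) = v ∧ (Sum.inr b : G.Port) ∈ T} = 2 := by
    rw [← hT2 v]
    convert (card_sum_filter (fun p : G.Port => G.pr p = v ∧ p ∈ T)).symm
  have hd : G.degOn S v = #{a : {q : V × E // q.1 ∈ G.inc q.2} |
      G.pr (.inl a) = v ∧ (Sum.inl a : G.Port) ∈ T} := by
    rw [G.degOn_eq]
    simp only [hS, Multigraph.pr]
    congr
  rw [← hd] at h2
  refine ⟨by omega, fun hlt => ?_⟩
  have hpos : 0 < #{b : (Σ v : V, Fin (G.maxDegree - G.degree v)) |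
      G.pr (.inr b) = v ∧ (Sum.inr b : G.Port) ∈ T} := by omega
  obtain ⟨⟨u, i⟩, hb⟩ := card_pos.1 hpos
  have hb' := (mem_filter.1 hb).2.1
  change u = v at hb'
  subst hb'
  have := i.2
  omega

end mainproof

/-- Every 2-edge-connected multigraph that is not regular has a
weak 2-factor: a spanning subgraph each of whose components is a cycle or a path
(possibly a single vertex) such that every endvertex of a path component has
degree strictly less than `Δ(G)` in `G`. -/
theorem weak_two_factor_exists {V E : Type} [Fintype V] [Fintype E]
    (G : Multigraph V E) (h2ec : G.TwoEdgeConnected) (hnreg : ¬ G.IsRegular) :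
    ∃ S : Set E, G.IsWeakTwoFactor S := by
  exact G.main h2ec hnreg
end

section
/- If G is a connected r-regular finite graph (multiple edges allowed, no loops) with r ≥ 2, and G is 2-edge-connected or has at most r−1 cutedges, then G has a 2-factor. -/
lemma exists_odd_family {W : Type} [Fintype W] [DecidableEq W] (H : SimpleGraph W)
    (hev : Even (Fintype.card W)) (h : ∀ M : H.Subgraph, ¬ M.IsPerfectMatching) :
    ∃ (S : Finset W) (𝒞 : Finset (Finset W)), S.card + 2 ≤ 𝒞.card ∧
      (∀ C ∈ 𝒞, Odd C.card ∧ (∀ x ∈ C, x ∉ S) ∧ ∀ x ∈ C, ∀ y, y ∉ C → H.Adj x y → y ∈ S) ∧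
      (∀ C ∈ 𝒞, ∀ D ∈ 𝒞, ∀ x ∈ C, x ∈ D → C = D) := by
  classical
  obtain ⟨u, hu⟩ := SimpleGraph.exists_isTutteViolator h (by simpa using hev)
  unfold SimpleGraph.IsTutteViolator at hu
  set K := ((⊤ : H.Subgraph).deleteVerts u).coe with hK
  have hpar := SimpleGraph.odd_ncard_oddComponents K
  let f : K.ConnectedComponent → Finset W := fun c => (Subtype.val '' c.supp).toFinset
  have hmem : ∀ c x, x ∈ f c ↔ ∃ hx : x ∈ ((⊤ : H.Subgraph).deleteVerts u).verts,
      K.connectedComponentMk ⟨x, hx⟩ = c := by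
    intro c x
    simp [f]
  have hfinj : Function.Injective f := by
    intro c d hcd
    obtain ⟨x, hx⟩ := c.exists_rep
    have : x.1 ∈ f c := (hmem _ _).2 ⟨x.2, hx⟩
    rw [hcd, hmem] at this
    obtain ⟨_, h2⟩ := this
    exact hx.symm.trans h2
  have hcard : ∀ c, (f c).card = c.supp.ncard := by
    intro c
    rw [← Set.ncard_image_of_injective c.supp Subtype.val_injective, Set.ncard_eq_toFinset_card']
  refine ⟨u.toFinset, K.oddComponents.toFinset.image f, ?_, ?_, ?_⟩
  · rw [Finset.card_image_of_injective _ hfinj, ← Set.ncard_eq_toFinset_card',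
      ← Set.ncard_eq_toFinset_card']
    have h1 : Nat.card ((⊤ : H.Subgraph).deleteVerts u).verts + u.ncard = Fintype.card W := by
      have := Set.ncard_add_ncard_compl u
      rw [Nat.card_eq_fintype_card] at this
      rw [← this, add_comm]
      congr 1
      simp [Set.compl_eq_univ_sdiff]
    rw [← h1] at hev
    by_contra hlt
    have h2 : K.oddComponents.ncard = u.ncard + 1 := by omega
    rw [h2] at hpar
    rw [Nat.even_add] at hev
    rw [Nat.odd_add_one, Nat.not_odd_iff_even, ← hev, ← Nat.not_even_iff_odd] at hpar
    tauto
  · intro C hC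
    obtain ⟨c, hc, rfl⟩ := Finset.mem_image.1 hC
    refine ⟨?_, ?_, ?_⟩
    · rw [hcard]; simpa using hc
    · intro x hx
      obtain ⟨h1, _⟩ := (hmem _ _).1 hx
      simpa using h1
    · intro x hx y hy hxy
      by_contra hyu
      obtain ⟨h1, h2⟩ := (hmem _ _).1 hx
      apply hy
      have hyv : y ∈ ((⊤ : H.Subgraph).deleteVerts u).verts := by simpa using hyu
      refine (hmem _ _).2 ⟨hyv, ?_⟩
      rw [← h2]
      apply SimpleGraph.ConnectedComponent.sound
      apply SimpleGraph.Adj.reachable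
      simp only [hK, SimpleGraph.Subgraph.coe_adj, SimpleGraph.Subgraph.deleteVerts_adj]
      simp at h1 hyu
      simp [h1, hyu, hxy.symm]
  · intro C hC D hD x hxC hxD
    obtain ⟨c, hc, rfl⟩ := Finset.mem_image.1 hC
    obtain ⟨d, hd, rfl⟩ := Finset.mem_image.1 hD
    obtain ⟨_, h1⟩ := (hmem _ _).1 hxC
    obtain ⟨_, h2⟩ := (hmem _ _).1 hxD
    rw [← h1, ← h2]

lemma weighted_tutte {W : Type} [Fintype W] [DecidableEq W] (H : SimpleGraph W)
    (hev : Even (Fintype.card W)) (w : W → W → ℕ) (r : ℕ) (hr : 0 < r)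
    (hw : ∀ x y, w x y ≠ 0 → H.Adj x y) (hsum : ∀ y, ∑ x, w x y = r)
    (bad : Finset W → Prop)
    (hgood : ∀ C : Finset W, Odd C.card → ¬ bad C → r ≤ ∑ x ∈ C, ∑ y ∈ Cᶜ, w x y)
    (hbadcut : ∀ C : Finset W, Odd C.card → bad C → r ≤ (∑ x ∈ C, ∑ y ∈ Cᶜ, w x y) + 2)
    (hbad : ∀ (S : Finset W) (𝒞 : Finset (Finset W)),
      (∀ C ∈ 𝒞, bad C ∧ (∀ x ∈ C, x ∉ S) ∧ ∀ x ∈ C, ∀ y, y ∉ C → H.Adj x y → y ∈ S) →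
      (∀ C ∈ 𝒞, ∀ D ∈ 𝒞, ∀ x ∈ C, x ∈ D → C = D) → 𝒞.card ≤ r - 1) :
    ∃ M : H.Subgraph, M.IsPerfectMatching := by
  classical
  by_contra! hno
  obtain ⟨S, 𝒞, hcard, hC, hdisj⟩ := exists_odd_family H hev hno
  have hb := hbad S (𝒞.filter bad) (by
    intro C h
    rw [Finset.mem_filter] at h
    exact ⟨h.2, (hC C h.1).2⟩) (by
    intro C h D h'
    exact hdisj C (Finset.mem_filter.1 h).1 D (Finset.mem_filter.1 h').1)
  have h1 : ∀ C ∈ 𝒞, r ≤ (∑ x ∈ C, ∑ y ∈ S, w x y) + (if bad C then 2 else 0) := by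
    intro C h
    have hle : ∑ x ∈ C, ∑ y ∈ Cᶜ, w x y ≤ ∑ x ∈ C, ∑ y ∈ S, w x y := by
      apply Finset.sum_le_sum
      intro x hx
      apply Finset.sum_le_sum_of_ne_zero
      intro y hy hne
      exact (hC C h).2.2 x hx y (by simpa using hy) (hw _ _ hne)
    split_ifs with hbd
    · have := hbadcut C (hC C h).1 hbd
      omega
    · have := hgood C (hC C h).1 hbd
      omega
  have h2 := Finset.sum_le_sum h1
  rw [Finset.sum_const, Finset.sum_add_distrib, ← Finset.sum_filter, Finset.sum_const,
    ← Finset.sum_biUnion] at h2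
  · have h3 : ∑ x ∈ 𝒞.biUnion (fun C => C), ∑ y ∈ S, w x y ≤ S.card * r := by
      calc _ ≤ ∑ x, ∑ y ∈ S, w x y := Finset.sum_le_sum_of_subset (Finset.subset_univ _)
        _ = ∑ y ∈ S, ∑ x, w x y := Finset.sum_comm
        _ = S.card * r := by simp [hsum]
    simp only [smul_eq_mul] at h2
    have h4 : (S.card + 2) * r ≤ 𝒞.card * r := Nat.mul_le_mul_right _ hcard
    have h5 : (S.card + 2) * r = S.card * r + 2 * r := by ring
    have h6 := h2.trans (Nat.add_le_add h3 (Nat.mul_le_mul_right 2 hb))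
    omega
  · intro C h D h' hne
    rw [Function.onFun, Finset.disjoint_left]
    intro x hx hx'
    exact hne (hdisj C h D h' x hx hx')

lemma even_card_of_invol {D : Type} (σ : D → D) (hσ : ∀ d, σ (σ d) = d)
    (hne : ∀ d, σ d ≠ d) (A : Finset D) (hA : ∀ d ∈ A, σ d ∈ A) : Even A.card := by
  have h : ∑ d ∈ A, (1 : ZMod 2) = 0 :=
    Finset.sum_involution (fun d _ => σ d) (fun _ _ => by decide) (fun d _ _ => hne d)
      (fun d hd => hA d hd) (fun d _ => hσ d)
  simp only [Finset.sum_const, nsmul_eq_mul, mul_one] at h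
  exact (ZMod.natCast_eq_zero_iff_even).1 h

section dart
variable {V D : Type} [Fintype V] [Fintype D] [DecidableEq V] [DecidableEq D]

/-- The weights of the gadget. -/
def gw (src : D → V) (σ : D → D) (r : ℕ) : (V × Bool) ⊕ D → (V × Bool) ⊕ D → ℕ
  | .inl _, .inl _ => 0
  | .inl a, .inr d => if src d = a.1 then 1 else 0
  | .inr d, .inl a => if src d = a.1 then 1 else 0
  | .inr d, .inr d' => if d' = σ d then r - 2 else 0

/-- Contribution of a dart to the cut. -/
def gd (src : D → V) (σ : D → D) (r : ℕ) (C : Finset ((V × Bool) ⊕ D)) (d : D) : ℕ :=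
  (∑ i : Bool, ((if .inl (src d, i) ∈ C ∧ .inr d ∉ C then 1 else 0) +
    (if .inr d ∈ C ∧ .inl (src d, i) ∉ C then 1 else 0))) +
    if .inr d ∈ C ∧ .inr (σ d) ∉ C then r - 2 else 0

lemma cut_eq_s7 (src : D → V) (σ : D → D) (r : ℕ) (C : Finset ((V × Bool) ⊕ D)) :
    ∑ x ∈ C, ∑ y ∈ Cᶜ, gw src σ r x y = ∑ d, gd src σ r C d := by
  have h : ∑ x ∈ C, ∑ y ∈ Cᶜ, gw src σ r x y =
      ∑ x, ∑ y, if x ∈ C ∧ y ∉ C then gw src σ r x y else 0 := by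
    rw [← Finset.sum_filter_add_sum_filter_not Finset.univ (· ∈ C)]
    rw [Finset.sum_eq_zero (s := Finset.univ.filter (¬ · ∈ C)), add_zero]
    · have : Finset.univ.filter (· ∈ C) = C := by ext; simp
      rw [this]
      apply Finset.sum_congr rfl
      intro x hx
      have : Finset.univ.filter (· ∉ C) = Cᶜ := by ext; simp
      simp [hx, ← this, Finset.sum_filter]
    · intro x hx
      simp at hx
      simp [hx]
  rw [h]
  simp only [Fintype.sum_sum_type, gw, gd, Finset.sum_add_distrib, ite_self, Finset.sum_const_zero,
    zero_add, ← add_assoc]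
  congr 1
  · rw [add_comm]
    congr 1
    · rw [Finset.sum_comm]
      apply Finset.sum_congr rfl
      intro d _
      rw [Fintype.sum_prod_type, Finset.sum_eq_single (src d)]
      · simp
      · intro v _ hv
        simp [hv.symm]
      · simp
    · apply Finset.sum_congr rfl
      intro d _
      rw [Fintype.sum_prod_type, Finset.sum_eq_single (src d)]
      · simp
      · intro v _ hv
        simp [hv.symm]
      · simp
  · apply Finset.sum_congr rfl
    intro d _
    rw [Finset.sum_eq_single (σ d)]
    · simp
    · intro v _ hv
      simp [hv]
    · simp

lemma bad_of_cut (src : D → V) (σ : D → D) (r : ℕ) (hr : 3 ≤ r) (hσ : ∀ d, σ (σ d) = d)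
    (hne : ∀ d, σ d ≠ d) (hreg : ∀ v, (Finset.univ.filter (fun d => src d = v)).card = r)
    (C : Finset ((V × Bool) ⊕ D)) (hodd : Odd C.card) (hcut : ∑ d, gd src σ r C d < r) :
    ∃ d, .inr d ∈ C ∧ .inr (σ d) ∉ C ∧
      ∃ U : Finset V, ∀ d', (src d' ∈ U ∧ src (σ d') ∉ U) ↔ d' = d := by
  have hk : ∀ v, Sum.inl (v, true) ∈ C ↔ Sum.inl (v, false) ∈ C := by
    intro v
    by_contra hv
    have h1 : ∀ d ∈ Finset.univ.filter (fun d => src d = v), 1 ≤ gd src σ r C d := by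
      intro d hd
      have hd : src d = v := by simpa using hd
      subst hd
      simp only [gd, Fintype.sum_bool]
      by_cases a : Sum.inl (src d, true) ∈ C <;> by_cases b : Sum.inl (src d, false) ∈ C <;>
        by_cases c : Sum.inr d ∈ C <;> simp [a, b, c] at hv ⊢ <;> omega
    have h2 := Finset.card_nsmul_le_sum _ _ _ h1
    rw [hreg] at h2
    have h3 : ∑ d ∈ Finset.univ.filter (fun d => src d = v), gd src σ r C d ≤
      ∑ d, gd src σ r C d := Finset.sum_le_sum_of_subset (Finset.subset_univ _)
    simp only [smul_eq_mul, mul_one] at h2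
    exact absurd (h2.trans h3) (by omega)
  let U : Finset V := Finset.univ.filter fun v => Sum.inl (v, true) ∈ C
  let A : Finset D := Finset.univ.filter fun d => Sum.inr d ∈ C
  let B : Finset D := Finset.univ.filter fun d => Sum.inr d ∈ C ∧ Sum.inr (σ d) ∉ C
  have hgd : ∀ d, gd src σ r C d = (if (d ∈ A ↔ src d ∈ U) then 0 else 2) +
      if d ∈ B then r - 2 else 0 := by
    intro d
    have := hk (src d)
    simp only [gd, Fintype.sum_bool, A, B, U, Finset.mem_filter, Finset.mem_univ, true_and]
    congr 1
    by_cases a : Sum.inl (src d, true) ∈ C <;> by_cases c : Sum.inr d ∈ C <;>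
      simp [a, c] at this ⊢ <;> simp [this]
  have hA : Odd A.card := by
    have : C.card = 2 * U.card + A.card := by
      have h0 : C.card = ∑ x, if x ∈ C then 1 else 0 := by
        rw [← Finset.card_filter]; congr 1; ext; simp
      rw [h0, Fintype.sum_sum_type, Fintype.sum_prod_type]
      simp only [Fintype.sum_bool, ← hk, A, U, Finset.card_filter, Finset.sum_add_distrib]
      ring
    rw [this] at hodd
    rw [Nat.odd_add] at hodd
    have h2 : Even (2 * U.card) := even_two_mul _
    rw [← Nat.not_even_iff_odd] at hodd ⊢
    tauto
  have hB : Odd B.card := by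
    have h1 : Even (A \ B).card := by
      apply even_card_of_invol σ hσ hne
      intro d
      simp only [A, B, Finset.mem_sdiff, Finset.mem_filter, Finset.mem_univ, true_and, hσ]
      tauto
    have h2 : B ⊆ A := by
      intro d
      simp only [A, B, Finset.mem_filter, Finset.mem_univ, true_and]
      tauto
    have h3 := Finset.card_sdiff_add_card_eq_card h2
    rw [← h3, Nat.odd_add'] at hA
    tauto
  have hsplit : ∑ d, gd src σ r C d =
      (∑ d, if (d ∈ A ↔ src d ∈ U) then 0 else 2) + B.card * (r - 2) := by
    rw [Finset.sum_congr rfl (fun d _ => hgd d), Finset.sum_add_distrib]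
    congr 1
    rw [← Finset.sum_filter]
    simp
  rw [hsplit] at hcut
  have hB1 : B.card = 1 := by
    by_contra hB1
    have : 3 ≤ B.card := by
      obtain ⟨k, hk⟩ := hB
      omega
    have := Nat.mul_le_mul_right (r - 2) this
    omega
  have hAU : ∀ d, d ∈ A ↔ src d ∈ U := by
    intro d
    by_contra hd
    have : 2 ≤ ∑ d, if (d ∈ A ↔ src d ∈ U) then 0 else 2 := by
      have := Finset.single_le_sum (f := fun d => if (d ∈ A ↔ src d ∈ U) then 0 else 2)
        (fun _ _ => Nat.zero_le _) (Finset.mem_univ d)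
      simpa only [if_neg hd] using this
    rw [hB1] at hcut
    omega
  obtain ⟨d, hd⟩ := Finset.card_eq_one.1 hB1
  have hBm : ∀ d', d' ∈ B ↔ (src d' ∈ U ∧ src (σ d') ∉ U) := by
    intro d'
    rw [← hAU, ← hAU]
    simp [A, B]
  refine ⟨d, ?_, ?_, U, ?_⟩
  · have : d ∈ B := by simp [hd]
    simp [B] at this
    exact this.1
  · have : d ∈ B := by simp [hd]
    simp [B] at this
    exact this.2
  · intro d'
    rw [← hBm, hd, Finset.mem_singleton]

theorem dart_two_factor (src : D → V) (σ : D → D) (r : ℕ) (hr : 3 ≤ r) (hσ : ∀ d, σ (σ d) = d)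
    (hne : ∀ d, σ d ≠ d) (hreg : ∀ v, (Finset.univ.filter (fun d => src d = v)).card = r)
    (hcut : ∀ T : Finset D, (∀ d ∈ T, σ d ∉ T ∧
      ∃ U : Finset V, ∀ d', (src d' ∈ U ∧ src (σ d') ∉ U) ↔ d' = d) → T.card ≤ r - 1) :
    ∃ M : Finset D, (∀ d ∈ M, σ d ∈ M) ∧ ∀ v, (M.filter (fun d => src d = v)).card = 2 := by
  have hσi : ∀ d d', d' = σ d ↔ d = σ d' := fun d d' =>
    ⟨fun h => by rw [h, hσ], fun h => by rw [h, hσ]⟩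
  have hsymm : ∀ x y, gw src σ r x y = gw src σ r y x := by
    rintro (a | d) (b | d') <;> simp only [gw]
    simp only [hσi d d']
  let H : SimpleGraph ((V × Bool) ⊕ D) :=
    { Adj := fun x y => gw src σ r x y ≠ 0
      symm := ⟨fun x y h => by rwa [hsymm]⟩
      loopless := ⟨by
        rintro (a | d) <;> simp [gw]
        intro h
        exact absurd h.symm (hne d)⟩ }
  have hD : Even (Fintype.card D) :=
    even_card_of_invol σ hσ hne Finset.univ (fun _ _ => Finset.mem_univ _)
  obtain ⟨M, hM⟩ := weighted_tutte H
    (by simp only [Fintype.card_sum, Fintype.card_prod, Fintype.card_bool]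
        exact (even_two.mul_left _).add hD) (gw src σ r) r (by omega) (fun x y h => h)
    (by
      rintro (a | d)
      · simp [gw, hreg]
      · simp only [gw, Fintype.sum_sum_type, Fintype.sum_prod_type]
        simp only [hσi _ d, Fintype.sum_bool, Finset.sum_add_distrib, Finset.sum_ite_eq,
          Finset.mem_univ, if_true, Finset.sum_ite_eq']
        omega)
    (fun C => ∃ d, .inr d ∈ C ∧ .inr (σ d) ∉ C ∧
      ∃ U : Finset V, ∀ d', (src d' ∈ U ∧ src (σ d') ∉ U) ↔ d' = d)
    (by
      intro C hC hb
      rw [cut_eq_s7]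
      by_contra hlt
      exact hb (bad_of_cut src σ r hr hσ hne hreg C hC (by omega)))
    (by
      rintro C hC ⟨d, h1, h2, -⟩
      rw [cut_eq_s7]
      have h3 : gd src σ r C d ≤ ∑ d, gd src σ r C d :=
        Finset.single_le_sum (fun _ _ => Nat.zero_le _) (Finset.mem_univ d)
      have h4 : r - 2 ≤ gd src σ r C d := by
        simp [gd, h1, h2]
      omega)
    (by
      intro S 𝒞 h𝒞 hdis
      rcases isEmpty_or_nonempty D with hE | hN
      · have : 𝒞 = ∅ := by
          apply Finset.eq_empty_of_forall_notMem
          intro C hC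
          obtain ⟨d, -⟩ := (h𝒞 C hC).1
          exact hE.elim d
        simp [this]
      choose! f hf using fun C hC => (h𝒞 C hC).1
      have hinj : Set.InjOn f 𝒞 := by
        intro C hC C' hC' h
        exact hdis C hC C' hC' _ (hf C hC).1 (h ▸ (hf C' hC').1)
      rw [← Finset.card_image_of_injOn hinj]
      apply hcut
      intro d hd
      obtain ⟨C, hC, rfl⟩ := Finset.mem_image.1 hd
      refine ⟨?_, (hf C hC).2.2⟩
      intro hd'
      obtain ⟨C', hC', h'⟩ := Finset.mem_image.1 hd'
      have hS : Sum.inr (σ (f C)) ∈ S := by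
        apply (h𝒞 C hC).2.2 _ (hf C hC).1 _ (hf C hC).2.1
        simp [H, gw]
        omega
      rw [← h'] at hS
      exact (h𝒞 C' hC').2.1 _ (hf C' hC').1 hS)
  rw [SimpleGraph.Subgraph.isPerfectMatching_iff] at hM
  choose m hm hmu using hM
  have hmm : ∀ x, m (m x) = x := fun x => (hmu _ _ (hm x).symm).symm
  have hmw : ∀ x, gw src σ r x (m x) ≠ 0 := fun x => (hm x).adj_sub
  refine ⟨Finset.univ.filter fun d => m (.inr d) ≠ .inr (σ d), ?_, ?_⟩
  · intro d
    simp only [Finset.mem_filter, Finset.mem_univ, true_and, hσ]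
    intro h h'
    apply h
    rw [← h', hmm]
  · intro v
    rw [← Fintype.card_bool, ← Finset.card_univ]
    have hl : ∀ i, ∃ d, m (.inl (v, i)) = .inr d ∧ src d = v := by
      intro i
      have := hmw (.inl (v, i))
      rcases h : m (.inl (v, i)) with a | d
      · simp [h, gw] at this
      · refine ⟨d, rfl, ?_⟩
        simp [h, gw] at this
        exact this
    choose f hf hfs using hl
    symm
    apply Finset.card_bij (fun i _ => f i)
    · intro i _
      simp only [Finset.mem_filter, Finset.mem_univ, true_and, hfs, and_true]
      rw [← hf, hmm]
      simp
    · intro i _ j _ hij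
      have : m (.inl (v, i)) = m (.inl (v, j)) := by rw [hf, hf, hij]
      have := congrArg m this
      simpa [hmm] using this
    · intro d hd
      simp only [Finset.mem_filter, Finset.mem_univ, true_and] at hd
      obtain ⟨h1, rfl⟩ := hd
      have := hmw (.inr d)
      rcases h : m (.inr d) with ⟨v, i⟩ | d'
      · simp [h, gw] at this
        subst this
        refine ⟨i, Finset.mem_univ _, ?_⟩
        have h5 := hf i
        rw [← h, hmm] at h5
        exact (Sum.inr_injective h5).symm
      · simp [h, gw] at this
        rw [h, this.1] at h1
        exact absurd rfl h1

end dart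

/-- If `G` is a connected `r`-regular multigraph with `r ≥ 2`,
and `G` is 2-edge-connected or has at most `r - 1` cutedges, then `G` has a
2-factor. -/
theorem two_factor_exists {V E : Type} [Fintype V] [Fintype E]
    (G : Multigraph V E) (r : ℕ) (hr : 2 ≤ r)
    (hconn : G.Connected) (hreg : ∀ v : V, G.degree v = r)
    (h : G.TwoEdgeConnected ∨ {e : E | G.IsCutedge e}.ncard ≤ r - 1) :
    ∃ F : Set E, ∀ v : V, G.degOn F v = 2 := by
  classical
  rcases Nat.lt_or_ge 2 r with hr3 | hr2
  swap
  · refine ⟨Set.univ, fun v => ?_⟩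
    have : r = 2 := by omega
    rw [← this]
    exact hreg v
  have hcard : {e : E | G.IsCutedge e}.ncard ≤ r - 1 := by
    rcases h with h | h
    · have : {e : E | G.IsCutedge e} = ∅ := by
        ext e
        simpa using h.2 e
      rw [this]
      simp
    · exact h
  let D := {p : E × V // p.2 ∈ G.inc p.1}
  let σ : D → D := fun d => ⟨(d.1.1, Sym2.Mem.other d.2), Sym2.other_mem d.2⟩
  let src : D → V := fun d => d.1.2
  let ed : D → E := fun d => d.1.1
  have hinc : ∀ d : D, G.inc (ed d) = s(src d, src (σ d)) := fun d => (Sym2.other_spec d.2).symm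
  have hσ : ∀ d, σ (σ d) = d := by
    intro d
    apply Subtype.ext
    exact Prod.ext rfl (Sym2.other_invol d.2 _)
  have hne : ∀ d, σ d ≠ d := by
    intro d hd
    have : src (σ d) = src d := by rw [hd]
    exact Sym2.other_ne (G.loopless _) d.2 this
  have hed : ∀ d d' : D, ed d = ed d' → d = d' ∨ σ d = d' := by
    intro d d' hdd
    have h1 : src d' ∈ G.inc (ed d) := hdd ▸ d'.2
    rw [hinc, Sym2.mem_iff] at h1
    rcases h1 with h1 | h1
    · left; exact Subtype.ext (Prod.ext hdd h1.symm)
    · right; exact Subtype.ext (Prod.ext hdd h1.symm)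
  have key : ∀ (M : Finset D) (v : V), (∀ d ∈ M, σ d ∈ M) →
      G.degOn (ed '' (M : Set D)) v = (M.filter (fun d => src d = v)).card := by
    intro M v hM
    unfold Multigraph.degOn
    rw [← Set.ncard_coe_finset, ← Set.ncard_image_of_injOn (f := ed)]
    · congr 1
      ext e
      simp only [Set.mem_image, Finset.mem_coe, Set.mem_setOf_eq, Finset.mem_filter]
      constructor
      · rintro ⟨⟨d, hd, rfl⟩, hv⟩
        rw [hinc, Sym2.mem_iff] at hv
        rcases hv with rfl | rfl
        · exact ⟨d, ⟨hd, rfl⟩, rfl⟩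
        · exact ⟨σ d, ⟨hM d hd, rfl⟩, rfl⟩
      · rintro ⟨d, ⟨hd, rfl⟩, rfl⟩
        exact ⟨⟨d, hd, rfl⟩, d.2⟩
    · intro d hd d' hd' hdd
      simp only [Finset.coe_filter, Set.mem_setOf_eq] at hd hd'
      exact Subtype.ext (Prod.ext hdd (hd.2.trans hd'.2.symm))
  obtain ⟨M, hM, hM2⟩ := dart_two_factor src σ r hr3 hσ hne
    (by
      intro v
      rw [← hreg v, ← key Finset.univ v (fun _ _ => Finset.mem_univ _)]
      unfold Multigraph.degree Multigraph.degOn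
      congr 1
      ext e
      simp only [Finset.coe_univ, Set.image_univ, Set.mem_range, Set.mem_setOf_eq, Set.mem_univ,
        true_and, and_iff_right_iff_imp]
      intro hv
      exact ⟨⟨(e, v), hv⟩, rfl⟩)
    (by
      intro T hT
      refine le_trans ?_ hcard
      rw [← Set.ncard_coe_finset]
      apply Set.ncard_le_ncard_of_injOn ed
      · intro d hd
        obtain ⟨-, U, hU⟩ := hT d hd
        have hd2 := (hU d).2 rfl
        refine ⟨src d, src (σ d), fun hreach => hd2.2 ?_⟩
        have : ∀ x, G.ReachOn {ed d}ᶜ (src d) x → x ∈ U := by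
          intro x hx
          induction hx with
          | refl => exact hd2.1
          | @tail y z _ hyz ih =>
            obtain ⟨e, he, hyz⟩ := hyz
            by_contra hz
            let d' : D := ⟨(e, y), by simp [hyz]⟩
            have h1 := hinc d'
            have h2 : src (σ d') = z := by
              have : s(y, src (σ d')) = s(y, z) := h1.symm.trans hyz
              exact Sym2.congr_right.1 this
            have := (hU d').1 ⟨ih, by rwa [h2]⟩
            apply he
            rw [← this]
            rfl
        exact this _ hreach
      · intro d hd d' hd' hdd
        rcases hed d d' hdd with h1 | h1
        · exact h1
        · exact absurd (h1 ▸ hd') (hT d hd).1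
      )
  exact ⟨_, fun v => (key M v hM).trans (hM2 v)⟩
end
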